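/- arXiv:1612.04219 — 7 statements merged into one kernel-verified Lean document; each statement's English description precedes it below -/
import Mathlib

section
/- For every n ∈ ℕ, a semigroup identity u = v over a finite alphabet Σ holds in the monoid M_n(𝕋) if and only if it holds in the semigroup M_n(𝔽𝕋). -/
/-- The tropical (max-plus) semiring `𝕋 = ℝ ∪ {-∞}`, with `⊕ = max` and `⊗ = +`. -/
abbrev TT : Type := WithBot ℝ

/-- Tropical (max-plus) multiplication of square matrices over `𝕋`:
`(A ⊗ B) i j = max_k (A i k + B k j)`. -/
def tmul {ι : Type} [Fintype ι] (A B : Matrix ι ι TT) : Matrix ι ι TT :=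
  fun i j => Finset.univ.sup fun k => A i k + B k j

/-- The image of a word under the semigroup homomorphism from the free semigroup `Σ⁺`
to tropical matrices determined by the letter assignment `a` (junk value on the empty word). -/
def evalWord {ι σ : Type} [Fintype ι] (a : σ → Matrix ι ι TT) : List σ → Matrix ι ι TT
  | [] => fun _ _ => ⊥
  | h :: t => t.foldl (fun M s => tmul M (a s)) (a h)

/-- A tropical matrix is upper triangular if all entries strictly below the diagonal are `-∞`. -/
def IsUT {n : ℕ} (A : Matrix (Fin n) (Fin n) TT) : Prop :=
  ∀ i j : Fin n, j < i → A i j = ⊥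

/-- The family `x t` stabilises to `y` as `t → -∞`: above every real threshold `r`, the values
`x t` and `y` eventually agree. -/
def StabilizesTo (x : ℝ → TT) (y : TT) : Prop :=
  ∀ r : ℝ, ∀ᶠ t in Filter.atBot, max (x t) (r : TT) = max y (r : TT)

namespace StabilizesTo

variable {x x' : ℝ → TT} {y y' : TT}

theorem coe_iff {c : ℝ} : StabilizesTo x (c : TT) ↔ ∀ᶠ t in Filter.atBot, x t = (c : TT) := by
  refine ⟨fun h => ?_, fun h r => h.mono fun t ht => by rw [ht]⟩
  filter_upwards [h (c - 1)] with t ht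
  have hlt : ((c - 1 : ℝ) : TT) < (c : TT) := WithBot.coe_lt_coe.2 (by linarith)
  rw [max_eq_left hlt.le] at ht
  rcases max_choice (x t) ((c - 1 : ℝ) : TT) with h' | h'
  · exact h'.symm.trans ht
  · exact absurd (h'.symm.trans ht) hlt.ne

theorem bot_iff : StabilizesTo x ⊥ ↔ ∀ r : ℝ, ∀ᶠ t in Filter.atBot, x t ≤ (r : TT) := by
  simp only [StabilizesTo, bot_le, max_eq_right, max_eq_right_iff]

theorem unique (h : StabilizesTo x y) (h' : StabilizesTo x y') : y = y' := by
  have key : ∀ r : ℝ, max y (r : TT) = max y' (r : TT) := fun r => by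
    obtain ⟨t, ht, ht'⟩ := ((h r).and (h' r)).exists
    exact ht.symm.trans ht'
  have le_of : ∀ {z z' : TT}, (∀ r : ℝ, max z (r : TT) = max z' (r : TT)) → z ≤ z' := by
    intro z z' hz
    by_contra! hlt
    obtain ⟨q, hq, hq'⟩ := exists_between hlt
    obtain ⟨r, rfl⟩ := WithBot.ne_bot_iff_exists.1 hq.ne_bot
    have hr := hz r
    rw [max_eq_left hq'.le, max_eq_right hq.le] at hr
    exact hq'.ne' hr
  exact le_antisymm (le_of key) (le_of fun r => (key r).symm)

theorem add (h : StabilizesTo x y) (h' : StabilizesTo x' y') :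
    StabilizesTo (fun t => x t + x' t) (y + y') := by
  induction y using WithBot.recBotCoe with
  | bot =>
    rw [WithBot.bot_add, bot_iff]
    rw [bot_iff] at h
    intro r
    induction y' using WithBot.recBotCoe with
    | bot =>
      filter_upwards [h r, bot_iff.1 h' 0] with t ht ht'
      simpa using add_le_add ht ht'
    | coe d =>
      filter_upwards [h (r - d), coe_iff.1 h'] with t ht ht'
      rw [ht']
      simpa [← WithBot.coe_add] using add_le_add_left ht (d : TT)
  | coe c =>
    rw [coe_iff] at h
    induction y' using WithBot.recBotCoe with
    | bot =>
      rw [WithBot.add_bot, bot_iff]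
      intro r
      filter_upwards [h, bot_iff.1 h' (r - c)] with t ht ht'
      rw [ht]
      simpa [← WithBot.coe_add] using add_le_add_right ht' (c : TT)
    | coe d =>
      rw [← WithBot.coe_add, coe_iff]
      filter_upwards [h, coe_iff.1 h'] with t ht ht'
      rw [ht, ht', WithBot.coe_add]

theorem finset_sup {ι : Type} (s : Finset ι) {f : ι → ℝ → TT} {g : ι → TT}
    (h : ∀ k ∈ s, StabilizesTo (f k) (g k)) :
    StabilizesTo (fun t => s.sup fun k => f k t) (s.sup g) := by
  intro r
  have hall : ∀ᶠ t in Filter.atBot, ∀ k ∈ s, max (f k t) (r : TT) = max (g k) (r : TT) :=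
    (Filter.eventually_all_finset s).2 fun k hk => h k hk r
  filter_upwards [hall] with t ht
  clear hall h
  induction s using Finset.cons_induction with
  | empty => simp
  | cons k s hk ih =>
    rw [Finset.sup_cons, Finset.sup_cons]
    have hk' := ht k (Finset.mem_cons_self k s)
    have ih' := ih fun j hj => ht j (Finset.mem_cons_of_mem hj)
    calc max (max (f k t) (s.sup fun j => f j t)) (r : TT)
        = max (max (f k t) (r : TT)) (max (s.sup fun j => f j t) (r : TT)) :=
          sup_sup_distrib_right _ _ _
      _ = max (max (g k) (r : TT)) (max (s.sup g) (r : TT)) := by rw [hk', ih']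
      _ = max (max (g k) (s.sup g)) (r : TT) := (sup_sup_distrib_right _ _ _).symm

theorem tmul {ι : Type} [Fintype ι] {A : ℝ → Matrix ι ι TT} {B : ℝ → Matrix ι ι TT}
    {A' B' : Matrix ι ι TT} (hA : ∀ i j, StabilizesTo (fun t => A t i j) (A' i j))
    (hB : ∀ i j, StabilizesTo (fun t => B t i j) (B' i j)) (i j : ι) :
    StabilizesTo (fun t => _root_.tmul (A t) (B t) i j) (_root_.tmul A' B' i j) :=
  finset_sup _ fun k _ => (hA i k).add (hB k j)

theorem foldl_tmul {ι σ : Type} [Fintype ι] {b : ℝ → σ → Matrix ι ι TT} {a : σ → Matrix ι ι TT}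
    (h : ∀ s i j, StabilizesTo (fun t => b t s i j) (a s i j)) (w : List σ)
    {A : ℝ → Matrix ι ι TT} {A' : Matrix ι ι TT}
    (hA : ∀ i j, StabilizesTo (fun t => A t i j) (A' i j)) (i j : ι) :
    StabilizesTo (fun t => w.foldl (fun M s => _root_.tmul M (b t s)) (A t) i j)
      (w.foldl (fun M s => _root_.tmul M (a s)) A' i j) := by
  induction w generalizing A A' with
  | nil => exact hA i j
  | cons s w ih => exact ih (tmul hA (h s))

theorem evalWord {ι σ : Type} [Fintype ι] {b : ℝ → σ → Matrix ι ι TT} {a : σ → Matrix ι ι TT}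
    (h : ∀ s i j, StabilizesTo (fun t => b t s i j) (a s i j)) (w : List σ) (i j : ι) :
    StabilizesTo (fun t => _root_.evalWord (b t) w i j) (_root_.evalWord a w i j) := by
  cases w with
  | nil => exact fun _ => Filter.Eventually.of_forall fun _ => rfl
  | cons s w => exact foldl_tmul h w (h s) i j

theorem max_coe (c : TT) : StabilizesTo (fun t => max c (t : TT)) c := by
  intro r
  filter_upwards [Filter.eventually_le_atBot r] with t ht
  rw [max_assoc, max_eq_right (WithBot.coe_le_coe.2 ht)]

end StabilizesTo


/-- For every `n`, a semigroup identity `u = v` over a finite alphabet `Σ`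
holds in the monoid `M_n(𝕋)` iff it holds in the semigroup `M_n(𝔽𝕋)` of matrices with all
entries real. (Semigroup homomorphisms `Σ⁺ → S` correspond exactly to letter assignments.) -/
theorem stmt_1 (n : ℕ) (σ : Type) [Fintype σ] (u v : List σ) (hu : u ≠ []) (hv : v ≠ []) :
    (∀ a : σ → Matrix (Fin n) (Fin n) TT, evalWord a u = evalWord a v)
    ↔ (∀ a : σ → Matrix (Fin n) (Fin n) TT, (∀ s i j, a s i j ≠ ⊥) →
        evalWord a u = evalWord a v) := by
  refine ⟨fun h a _ => h a, fun h a => ?_⟩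
  let b : ℝ → σ → Matrix (Fin n) (Fin n) TT := fun t s i j => max (a s i j) (t : TT)
  have hb : ∀ s i j, StabilizesTo (fun t => b t s i j) (a s i j) :=
    fun s i j => StabilizesTo.max_coe (a s i j)
  have hfin : ∀ t s i j, b t s i j ≠ ⊥ := fun t s i j =>
    ((WithBot.bot_lt_coe t).trans_le (le_max_right _ _)).ne'
  ext1 i j
  have hu' := StabilizesTo.evalWord hb u i j
  simp only [fun t => h (b t) (hfin t)] at hu'
  exact hu'.unique (StabilizesTo.evalWord hb v i j)
end

section
/- For every n ∈ ℕ, a semigroup identity u = v over a finite alphabet Σ holds in UT_n(𝕋) if and only if it holds in UT_n(𝔽𝕋). -/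
open Filter

/-- `x` is an asymptotic upper bound of `f` as its real parameter tends to `-∞`:
every `x ⊔ B` with `B` real eventually bounds `f`. -/
def AsymptoticUB (f : ℝ → TT) (x : TT) : Prop :=
  ∀ B : ℝ, ∀ᶠ M in atBot, f M ≤ x ⊔ (B : TT)

theorem TT.exists_real_ge (x : TT) : ∃ X : ℝ, x ≤ (X : TT) := by
  induction x using WithBot.recBotCoe with
  | bot => exact ⟨0, bot_le⟩
  | coe r => exact ⟨r, le_rfl⟩

theorem TT.le_of_forall_real_le_sup {x y : TT} (h : ∀ B : ℝ, y ≤ x ⊔ (B : TT)) : y ≤ x := by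
  induction y using WithBot.recBotCoe with
  | bot => exact bot_le
  | coe r =>
    refine (le_sup_iff.1 (h (r - 1))).resolve_right fun hr => ?_
    have := WithBot.coe_le_coe.1 hr
    linarith

theorem AsymptoticUB.add {f g : ℝ → TT} {x y : TT} (hf : AsymptoticUB f x)
    (hg : AsymptoticUB g y) : AsymptoticUB (fun M => f M + g M) (x + y) := by
  intro B
  obtain ⟨X, hX⟩ := TT.exists_real_ge x
  obtain ⟨Y, hY⟩ := TT.exists_real_ge y
  filter_upwards [hf (min (B - Y) (B / 2)), hg (min (B - X) (B / 2))] with M hfM hgM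
  set C := min (B - Y) (B / 2)
  set D := min (B - X) (B / 2)
  have hCY : C + Y ≤ B := by linarith [min_le_left (B - Y) (B / 2)]
  have hXD : X + D ≤ B := by linarith [min_le_left (B - X) (B / 2)]
  have hCD : C + D ≤ B := by
    linarith [min_le_right (B - Y) (B / 2), min_le_right (B - X) (B / 2)]
  refine (add_le_add hfM hgM).trans ?_
  rcases le_total x (C : TT) with hx | hx <;> rcases le_total y (D : TT) with hy | hy
  · rw [sup_eq_right.2 hx, sup_eq_right.2 hy]
    exact le_sup_of_le_right (by exact_mod_cast hCD)
  · rw [sup_eq_right.2 hx, sup_eq_left.2 hy]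
    exact le_sup_of_le_right ((add_le_add le_rfl hY).trans (by exact_mod_cast hCY))
  · rw [sup_eq_left.2 hx, sup_eq_right.2 hy]
    exact le_sup_of_le_right ((add_le_add hX le_rfl).trans (by exact_mod_cast hXD))
  · rw [sup_eq_left.2 hx, sup_eq_left.2 hy]
    exact le_sup_left

theorem AsymptoticUB.finset_sup {κ : Type} [Fintype κ] {f : ℝ → κ → TT} {x : κ → TT}
    (h : ∀ k, AsymptoticUB (fun M => f M k) (x k)) :
    AsymptoticUB (fun M => Finset.univ.sup (f M)) (Finset.univ.sup x) := by
  intro B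
  filter_upwards [eventually_all.2 fun k => h k B] with M hM
  exact Finset.sup_le fun k hk => (hM k).trans (sup_le_sup_right (Finset.le_sup hk) _)

theorem tmul_mono {ι : Type} [Fintype ι] {A A' B B' : Matrix ι ι TT}
    (hA : ∀ i j, A i j ≤ A' i j) (hB : ∀ i j, B i j ≤ B' i j) (i j : ι) :
    tmul A B i j ≤ tmul A' B' i j :=
  Finset.sup_mono_fun fun k _ => add_le_add (hA i k) (hB k j)

theorem evalWord_concat {ι σ : Type} [Fintype ι] (a : σ → Matrix ι ι TT) {w : List σ}
    (hw : w ≠ []) (s : σ) : evalWord a (w ++ [s]) = tmul (evalWord a w) (a s) := by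
  cases w with
  | nil => exact absurd rfl hw
  | cons r t => simp [evalWord]

theorem evalWord_mono {ι σ : Type} [Fintype ι] {a b : σ → Matrix ι ι TT}
    (h : ∀ s i j, a s i j ≤ b s i j) (w : List σ) (i j : ι) :
    evalWord a w i j ≤ evalWord b w i j := by
  induction w using List.reverseRecOn generalizing i j with
  | nil => exact le_rfl
  | append_singleton t s ih =>
    rcases eq_or_ne t [] with rfl | ht
    · exact h s i j
    · rw [evalWord_concat a ht, evalWord_concat b ht]
      exact tmul_mono ih (h s) i j

theorem AsymptoticUB.evalWord {ι σ : Type} [Fintype ι] {a : σ → Matrix ι ι TT}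
    {b : ℝ → σ → Matrix ι ι TT} (h : ∀ s i j, AsymptoticUB (fun M => b M s i j) (a s i j))
    (w : List σ) (i j : ι) :
    AsymptoticUB (fun M => _root_.evalWord (b M) w i j) (_root_.evalWord a w i j) := by
  induction w using List.reverseRecOn generalizing i j with
  | nil => exact fun B => Eventually.of_forall fun M => bot_le
  | append_singleton t s ih =>
    rcases eq_or_ne t [] with rfl | ht
    · exact h s i j
    · simp only [evalWord_concat _ ht]
      exact AsymptoticUB.finset_sup fun k => (ih i k).add (h s k j)

/-- Replace every entry on or above the diagonal by its maximum with the real number `M`. -/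
noncomputable def raiseUpper {n : ℕ} (M : ℝ) (A : Matrix (Fin n) (Fin n) TT) :
    Matrix (Fin n) (Fin n) TT :=
  fun i j => if i ≤ j then A i j ⊔ (M : TT) else A i j

theorem le_raiseUpper {n : ℕ} (M : ℝ) (A : Matrix (Fin n) (Fin n) TT) (i j : Fin n) :
    A i j ≤ raiseUpper M A i j := by
  unfold raiseUpper
  split_ifs
  · exact le_sup_left
  · exact le_rfl

theorem IsUT.raiseUpper {n : ℕ} {A : Matrix (Fin n) (Fin n) TT} (hA : IsUT A) (M : ℝ) :
    IsUT (raiseUpper M A) := fun i j hij => by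
  rw [_root_.raiseUpper, if_neg hij.not_ge, hA i j hij]

theorem raiseUpper_ne_bot {n : ℕ} (M : ℝ) (A : Matrix (Fin n) (Fin n) TT) {i j : Fin n}
    (hij : i ≤ j) : raiseUpper M A i j ≠ ⊥ := by
  rw [raiseUpper, if_pos hij]
  exact ((WithBot.bot_lt_coe M).trans_le le_sup_right).ne'

theorem asymptoticUB_raiseUpper {n : ℕ} (A : Matrix (Fin n) (Fin n) TT) (i j : Fin n) :
    AsymptoticUB (fun M => raiseUpper M A i j) (A i j) := by
  intro B
  filter_upwards [eventually_le_atBot B] with M hM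
  unfold raiseUpper
  split_ifs
  · exact sup_le_sup_left (WithBot.coe_le_coe.2 hM) _
  · exact le_sup_left

theorem evalWord_le_of_forall_raiseUpper_eq {n : ℕ} {σ : Type}
    {a : σ → Matrix (Fin n) (Fin n) TT} {u v : List σ}
    (h : ∀ M, evalWord (fun s => raiseUpper M (a s)) u = evalWord (fun s => raiseUpper M (a s)) v)
    (i j : Fin n) : evalWord a u i j ≤ evalWord a v i j := by
  refine TT.le_of_forall_real_le_sup fun B => ?_
  obtain ⟨M, hM⟩ :=
    (AsymptoticUB.evalWord (fun s => asymptoticUB_raiseUpper (a s)) v i j B).exists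
  calc evalWord a u i j ≤ evalWord (fun s => raiseUpper M (a s)) u i j :=
        evalWord_mono (fun s => le_raiseUpper M (a s)) u i j
    _ = evalWord (fun s => raiseUpper M (a s)) v i j := by rw [h M]
    _ ≤ evalWord a v i j ⊔ (B : TT) := hM

/-- For every `n`, a semigroup identity `u = v` over a finite alphabet `Σ`
holds in `UT_n(𝕋)` iff it holds in `UT_n(𝔽𝕋)` (upper triangular matrices whose entries on and
above the diagonal are real). -/
theorem stmt_2 (n : ℕ) (σ : Type) [Fintype σ] (u v : List σ) (hu : u ≠ []) (hv : v ≠ []) :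
    (∀ a : σ → Matrix (Fin n) (Fin n) TT, (∀ s, IsUT (a s)) → evalWord a u = evalWord a v)
    ↔ (∀ a : σ → Matrix (Fin n) (Fin n) TT, (∀ s, IsUT (a s)) →
        (∀ s i j, i ≤ j → a s i j ≠ ⊥) → evalWord a u = evalWord a v) := by
  refine ⟨fun h a ha _ => h a ha, fun h a ha => ?_⟩
  have heq (M : ℝ) : evalWord (fun s => raiseUpper M (a s)) u =
      evalWord (fun s => raiseUpper M (a s)) v :=
    h _ (fun s => (ha s).raiseUpper M) fun s i j => raiseUpper_ne_bot M (a s)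
  ext i j
  exact le_antisymm (evalWord_le_of_forall_raiseUpper_eq heq i j)
    (evalWord_le_of_forall_raiseUpper_eq (fun M => (heq M).symm) i j)
end

section
/- Let w, v be words over a finite alphabet Σ. If f_t^w(x) = f_t^v(x) for all t ∈ Σ and all x ∈ ℝ^Σ, then w and v have the same content, i.e. |w|_s = |v|_s for every s ∈ Σ. -/
/-- The tropical polynomial function `f_t^w` associated to a word `w` and letter `t`:
`f_t^w(x) = max` over (1-based) positions `i` of `w` carrying the letter `t` of
`∑_{s ∈ Σ} λ_s^w(i-1) ⬝ x_s`, where `λ_s^w(i-1)` counts occurrences of `s` among the first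
`i-1` letters of `w`; the maximum over the empty set is `-∞`. -/
def fpoly {σ : Type} [Fintype σ] [DecidableEq σ] (w : List σ) (t : σ) (x : σ → ℝ) : TT :=
  (Finset.univ.filter (fun i : Fin w.length => w.get i = t)).sup
    (fun i => (((∑ s : σ, ((w.take i.val).count s : ℝ) * x s) : ℝ) : TT))

/-- At the indicator vector of `s`, the exponent sum of a word is its number of `s`. -/
lemma sum_count_mul_single {σ : Type} [Fintype σ] [DecidableEq σ] (l : List σ) (s : σ) :
    ∑ r : σ, (l.count r : ℝ) * (Pi.single s 1 : σ → ℝ) r = l.count s := by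
  simp [Pi.single_apply]

/-- The last occurrence of a letter is preceded by all its other occurrences. -/
lemma exists_get_eq_count_take_add_one {σ : Type} [DecidableEq σ] {w : List σ} {s : σ}
    (hs : s ∈ w) :
    ∃ i : Fin w.length, w.get i = s ∧ (w.take i.val).count s + 1 = w.count s := by
  obtain ⟨l, r, hw, hl⟩ := List.eq_append_cons_of_mem (List.mem_reverse.2 hs)
  obtain rfl : w = r.reverse ++ s :: l.reverse := by simpa using congrArg List.reverse hw
  refine ⟨⟨r.reverse.length, by simp⟩, by simp, ?_⟩
  rw [List.take_left]
  simp [List.count_eq_zero_of_not_mem hl]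

/-- The number of `s` strictly before an occurrence of `s` is less than the total number. -/
lemma count_take_lt_count_get {σ : Type} [DecidableEq σ] (w : List σ) (i : Fin w.length) :
    (w.take i.val).count (w.get i) < w.count (w.get i) := by
  have h := (List.take_sublist (i.val + 1) w).count_le (w.get i)
  rw [List.take_succ_eq_append_getElem i.isLt, List.count_append] at h
  simp at h ⊢
  omega

lemma fpoly_single_lt_count {σ : Type} [Fintype σ] [DecidableEq σ] (w : List σ) (s : σ) :
    fpoly w s (Pi.single s 1) < ((w.count s : ℝ) : TT) := by
  refine (Finset.sup_lt_iff (WithBot.bot_lt_coe _)).2 fun i hi => ?_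
  obtain rfl := (Finset.mem_filter.1 hi).2
  rw [sum_count_mul_single, WithBot.coe_lt_coe, Nat.cast_lt]
  exact count_take_lt_count_get w i

lemma exists_le_fpoly_single {σ : Type} [Fintype σ] [DecidableEq σ] {w : List σ} {s : σ}
    (hs : s ∈ w) :
    ∃ n : ℕ, n + 1 = w.count s ∧ ((n : ℝ) : TT) ≤ fpoly w s (Pi.single s 1) := by
  obtain ⟨i, hi, hc⟩ := exists_get_eq_count_take_add_one hs
  refine ⟨_, hc, ?_⟩
  rw [← sum_count_mul_single]
  exact Finset.le_sup (f := fun i : Fin w.length =>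
    ((∑ r : σ, ((w.take i.val).count r : ℝ) * (Pi.single s 1 : σ → ℝ) r : ℝ) : TT))
    (Finset.mem_filter.2 ⟨Finset.mem_univ i, hi⟩)

lemma count_le_count_of_fpoly_single_le {σ : Type} [Fintype σ] [DecidableEq σ]
    {w v : List σ} {s : σ}
    (h : fpoly w s (Pi.single s 1) ≤ fpoly v s (Pi.single s 1)) :
    w.count s ≤ v.count s := by
  by_cases hs : s ∈ w
  · obtain ⟨n, hn, hle⟩ := exists_le_fpoly_single hs
    have hlt := (hle.trans h).trans_lt (fpoly_single_lt_count v s)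
    rw [WithBot.coe_lt_coe, Nat.cast_lt] at hlt
    omega
  · simp [List.count_eq_zero_of_not_mem hs]

/-- If `f_t^w = f_t^v` as functions on `ℝ^Σ` for every letter `t`, then
`w` and `v` have the same content. -/
theorem stmt_6 (σ : Type) [Fintype σ] [DecidableEq σ] (w v : List σ)
    (h : ∀ (t : σ) (x : σ → ℝ), fpoly w t x = fpoly v t x) :
    ∀ s : σ, w.count s = v.count s := by
  exact fun s => le_antisymm
    (count_le_count_of_fpoly_single_le (h s _).le)
    (count_le_count_of_fpoly_single_le (h s _).ge)
end

section
/- A semigroup identity w = v over a finite alphabet Σ holds in UT_2(𝕋) if and only if f_t^w(x) = f_t^v(x) for all t ∈ Σ and all x ∈ ℝ^Σ. -/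
theorem List.sum_map_eq_sum_count_mul {σ : Type*} [Fintype σ] [DecidableEq σ]
    (l : List σ) (x : σ → ℝ) : (l.map x).sum = ∑ s : σ, (l.count s : ℝ) * x s := by
  induction l with
  | nil => simp
  | cons h l ih =>
    simp [List.count_cons, ih, add_mul, Finset.sum_add_distrib, add_comm]

theorem List.sum_map_sub_eq {σ : Type*} (l : List σ) (f g : σ → ℝ) :
    (l.map fun s => f s - g s).sum = (l.map f).sum - (l.map g).sum := by
  induction l with
  | nil => simp
  | cons h l ih => simp [ih, add_sub_add_comm]

theorem coe_le_fpoly_iff {σ : Type} [Fintype σ] [DecidableEq σ] (w : List σ) (t : σ)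
    (x : σ → ℝ) (c : ℝ) :
    (c : TT) ≤ fpoly w t x ↔ ∃ p q, w = p ++ t :: q ∧ c ≤ (p.map x).sum := by
  rw [fpoly, Finset.le_sup_iff (WithBot.bot_lt_coe c)]
  simp only [Finset.mem_filter, Finset.mem_univ, true_and, ← List.sum_map_eq_sum_count_mul,
    WithBot.coe_le_coe]
  constructor
  · rintro ⟨i, rfl, hc⟩
    exact ⟨w.take i, w.drop (i + 1), by simp, hc⟩
  · rintro ⟨p, q, rfl, hc⟩
    exact ⟨⟨p.length, by simp⟩, by simp, by simpa using hc⟩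

theorem IsUT.tmul_apply {A B : Matrix (Fin 2) (Fin 2) TT} (hA : IsUT A) (hB : IsUT B) :
    tmul A B 0 0 = A 0 0 + B 0 0 ∧ tmul A B 1 1 = A 1 1 + B 1 1 ∧ tmul A B 1 0 = ⊥ ∧
      tmul A B 0 1 = (A 0 0 + B 0 1) ⊔ (A 0 1 + B 1 1) := by
  have hA' : A 1 0 = ⊥ := hA 1 0 (by decide)
  have hB' : B 1 0 = ⊥ := hB 1 0 (by decide)
  simp [tmul, Fin.univ_succ, hA', hB']

theorem isUT_two_iff {A : Matrix (Fin 2) (Fin 2) TT} : IsUT A ↔ A 1 0 = ⊥ := by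
  simp [IsUT, Fin.forall_fin_two]

theorem foldl_tmul_apply {σ : Type} (a : σ → Matrix (Fin 2) (Fin 2) TT)
    (ha : ∀ s, IsUT (a s)) (l : List σ) (M : Matrix (Fin 2) (Fin 2) TT) (hM : IsUT M) :
    let F := l.foldl (fun M s => tmul M (a s)) M
    F 0 0 = M 0 0 + (l.map fun s => a s 0 0).sum ∧
    F 1 1 = M 1 1 + (l.map fun s => a s 1 1).sum ∧ F 1 0 = ⊥ ∧
    ∀ c : ℝ, (c : TT) ≤ F 0 1 ↔ (c : TT) ≤ M 0 1 + (l.map fun s => a s 1 1).sum ∨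
      ∃ p t q, l = p ++ t :: q ∧ (c : TT) ≤
        M 0 0 + ((p.map fun s => a s 0 0).sum + a t 0 1 + (q.map fun s => a s 1 1).sum) := by
  induction l generalizing M with
  | nil => simpa using isUT_two_iff.1 hM
  | cons h l ih =>
    obtain ⟨h00, h11, h10, h01⟩ := hM.tmul_apply (ha h)
    obtain ⟨i00, i11, i10, i01⟩ := ih (tmul M (a h)) (isUT_two_iff.2 h10)
    refine ⟨by simp [i00, h00, add_assoc], by simp [i11, h11, add_assoc], i10, fun c => ?_⟩
    rw [List.foldl_cons, i01, h01, h00, max_add, le_sup_iff]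
    constructor
    · rintro ((hc | hc) | ⟨p, t, q, rfl, hc⟩)
      · exact .inr ⟨[], h, l, rfl, by simpa [add_assoc] using hc⟩
      · exact .inl (by simpa [add_assoc] using hc)
      · exact .inr ⟨h :: p, t, q, rfl, by simpa [add_assoc] using hc⟩
    · rintro (hc | ⟨p, t, q, hl, hc⟩)
      · exact .inl (.inr (by simpa [add_assoc] using hc))
      · cases p with
        | nil =>
          obtain ⟨rfl, rfl⟩ : h = t ∧ l = q := by simpa using hl
          exact .inl (.inl (by simpa [add_assoc] using hc))
        | cons k p =>
          obtain ⟨rfl, rfl⟩ : h = k ∧ l = p ++ t :: q := by simpa using hl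
          exact .inr ⟨p, t, q, rfl, by simpa [add_assoc] using hc⟩

theorem evalWord_apply {σ : Type} (a : σ → Matrix (Fin 2) (Fin 2) TT)
    (ha : ∀ s, IsUT (a s)) (w : List σ) (hw : w ≠ []) :
    evalWord a w 0 0 = (w.map fun s => a s 0 0).sum ∧
    evalWord a w 1 1 = (w.map fun s => a s 1 1).sum ∧ evalWord a w 1 0 = ⊥ ∧
    ∀ c : ℝ, (c : TT) ≤ evalWord a w 0 1 ↔ ∃ p t q, w = p ++ t :: q ∧ (c : TT) ≤
      (p.map fun s => a s 0 0).sum + a t 0 1 + (q.map fun s => a s 1 1).sum := by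
  cases w with
  | nil => exact absurd rfl hw
  | cons h l =>
    obtain ⟨i00, i11, i10, i01⟩ := foldl_tmul_apply a ha l (a h) (ha h)
    refine ⟨by simpa [evalWord] using i00, by simpa [evalWord] using i11, i10, fun c => ?_⟩
    rw [evalWord, i01]
    constructor
    · rintro (hc | ⟨p, t, q, rfl, hc⟩)
      · exact ⟨[], h, l, rfl, by simpa [add_assoc] using hc⟩
      · exact ⟨h :: p, t, q, rfl, by simpa [add_assoc] using hc⟩
    · rintro ⟨p, t, q, hl, hc⟩
      cases p with
      | nil =>
        obtain ⟨rfl, rfl⟩ : h = t ∧ l = q := by simpa using hl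
        exact .inl (by simpa [add_assoc] using hc)
      | cons k p =>
        obtain ⟨rfl, rfl⟩ : h = k ∧ l = p ++ t :: q := by simpa using hl
        exact .inr ⟨p, t, q, rfl, by simpa [add_assoc] using hc⟩

theorem List.exists_eq_append_cons_notMem_right {α : Type*} {a : α} {l : List α} (h : a ∈ l) :
    ∃ p q, l = p ++ a :: q ∧ a ∉ q := by
  obtain ⟨p, q, hl, hp⟩ := List.eq_append_cons_of_mem (List.mem_reverse.2 h)
  exact ⟨q.reverse, p.reverse, by simpa using congrArg List.reverse hl, by simpa using hp⟩

theorem sum_map_single_eq_count {σ : Type*} [Fintype σ] [DecidableEq σ] (l : List σ) (t : σ) :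
    (l.map (Pi.single t (1 : ℝ))).sum = l.count t := by
  simp [List.sum_map_eq_sum_count_mul, Pi.single_apply]

theorem count_le_of_fpoly_eq {σ : Type} [Fintype σ] [DecidableEq σ] {w v : List σ} {t : σ}
    (h : ∀ x : σ → ℝ, fpoly w t x = fpoly v t x) : w.count t ≤ v.count t := by
  by_cases ht : t ∈ w
  · obtain ⟨p, q, rfl, hq⟩ := List.exists_eq_append_cons_notMem_right ht
    have hp := (coe_le_fpoly_iff (p ++ t :: q) t (Pi.single t 1) (p.count t)).2
      ⟨p, q, rfl, (sum_map_single_eq_count p t).ge⟩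
    rw [h, coe_le_fpoly_iff] at hp
    obtain ⟨p', q', rfl, hc⟩ := hp
    rw [sum_map_single_eq_count, Nat.cast_le] at hc
    simp [List.count_eq_zero_of_not_mem hq]
    omega
  · simp [List.count_eq_zero_of_not_mem ht]

/-- Replace the value `-∞` by the real number `-N`. -/
def truncBot (N : ℝ) (y : TT) : ℝ := y.unbotD (-N)

theorem sum_map_truncBot_le {σ : Type*} {g : σ → TT} {M N : ℝ} (hM : 0 ≤ M) (hN : 0 ≤ N)
    (hg : ∀ s, (g s).unbotD 0 ≤ M) (l : List σ) :
    (l.map fun s => truncBot N (g s)).sum ≤ l.length * M ∧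
    ((l.map g).sum = ⊥ → (l.map fun s => truncBot N (g s)).sum ≤ l.length * M - N) ∧
    ((l.map g).sum ≠ ⊥ →
      (l.map g).sum = ((l.map fun s => truncBot N (g s)).sum : ℝ)) := by
  induction l with
  | nil => simp
  | cons h l ih =>
    obtain ⟨ih1, ih2, ih3⟩ := ih
    have hh := hg h
    cases hgh : g h using WithBot.recBotCoe with
    | bot =>
      simp only [List.map_cons, List.sum_cons, hgh, truncBot, WithBot.unbotD_bot,
        List.length_cons, Nat.cast_succ, WithBot.bot_add, ne_eq, not_true_eq_false,
        false_imp_iff, true_imp_iff, and_true] at *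
      constructor <;> linarith
    | coe y =>
      simp only [List.map_cons, List.sum_cons, hgh, truncBot, WithBot.unbotD_coe,
        List.length_cons, Nat.cast_succ, WithBot.add_eq_bot, WithBot.coe_ne_bot,
        false_or, ne_eq, WithBot.coe_add] at *
      refine ⟨by linarith, fun hb => ?_, fun hb => by rw [← ih3 hb]⟩
      linarith [ih2 hb]

theorem exists_split_of_fpoly_eq {σ : Type} [Fintype σ] [DecidableEq σ] {w v : List σ} {t : σ}
    (hwv : w.Perm v) (h : ∀ x : σ → ℝ, fpoly w t x = fpoly v t x) (α δ : σ → TT)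
    {p q : List σ} (hw : w = p ++ t :: q) :
    ∃ p' q', v = p' ++ t :: q' ∧
      (p.map α).sum + (q.map δ).sum ≤ (p'.map α).sum + (q'.map δ).sum := by
  obtain ⟨M, hM, hα, hδ⟩ : ∃ M : ℝ, 0 ≤ M ∧ (∀ s, (α s).unbotD 0 ≤ M) ∧
      ∀ s, (δ s).unbotD 0 ≤ M := by
    obtain ⟨A, hA⟩ := (Set.finite_range fun s => (α s).unbotD 0).bddAbove
    obtain ⟨D, hD⟩ := (Set.finite_range fun s => (δ s).unbotD 0).bddAbove
    exact ⟨0 ⊔ (A ⊔ D), le_sup_left,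
      fun s => (hA ⟨s, rfl⟩).trans (le_sup_left.trans le_sup_right),
      fun s => (hD ⟨s, rfl⟩).trans (le_sup_right.trans le_sup_right)⟩
  have key : ∀ N : ℝ, ∃ p' q', v = p' ++ t :: q' ∧
      (p.map fun s => truncBot N (α s)).sum + (q.map fun s => truncBot N (δ s)).sum ≤
      (p'.map fun s => truncBot N (α s)).sum + (q'.map fun s => truncBot N (δ s)).sum := by
    intro N
    have hp := (coe_le_fpoly_iff w t (fun s => truncBot N (α s) - truncBot N (δ s)) _).2
      ⟨p, q, hw, le_rfl⟩
    rw [h, coe_le_fpoly_iff] at hp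
    obtain ⟨p', q', rfl, hc⟩ := hp
    have hs := (hwv.map fun s => truncBot N (δ s)).sum_eq
    refine ⟨p', q', rfl, ?_⟩
    simp only [hw, List.map_append, List.map_cons, List.sum_append, List.sum_cons,
      List.sum_map_sub_eq] at hc hs
    linarith
  by_cases hpα : (p.map α).sum = ⊥
  · obtain ⟨p', q', hv, -⟩ := key 0
    exact ⟨p', q', hv, by simp [hpα]⟩
  by_cases hqδ : (q.map δ).sum = ⊥
  · obtain ⟨p', q', hv, -⟩ := key 0
    exact ⟨p', q', hv, by simp [hqδ]⟩
  obtain ⟨A, hA⟩ := WithBot.ne_bot_iff_exists.1 hpα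
  obtain ⟨D, hD⟩ := WithBot.ne_bot_iff_exists.1 hqδ
  obtain ⟨N, hN, hNv⟩ : ∃ N : ℝ, 0 ≤ N ∧ v.length * M - (A + D) < N :=
    ⟨0 ⊔ (v.length * M - (A + D) + 1), le_sup_left,
      (lt_add_one _).trans_le le_sup_right⟩
  obtain ⟨p', q', rfl, hc⟩ := key N
  refine ⟨p', q', rfl, ?_⟩
  have hA' := (sum_map_truncBot_le hM hN hα p).2.2 hpα
  have hD' := (sum_map_truncBot_le hM hN hδ q).2.2 hqδ
  rw [← hA, WithBot.coe_inj] at hA'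
  rw [← hD, WithBot.coe_inj] at hD'
  obtain ⟨a1, a2, a3⟩ := sum_map_truncBot_le hM hN hα p'
  obtain ⟨d1, d2, d3⟩ := sum_map_truncBot_le hM hN hδ q'
  simp only [List.length_append, List.length_cons, Nat.cast_add, Nat.cast_succ] at hNv
  rw [← hA', ← hD'] at hc
  have hp' : (p'.map α).sum ≠ ⊥ := fun hb => by linarith [a2 hb]
  have hq' : (q'.map δ).sum ≠ ⊥ := fun hb => by linarith [d2 hb]
  rw [a3 hp', d3 hq', ← hA, ← hD]
  exact_mod_cast hc

theorem coe_le_evalWord_of_fpoly_eq {σ : Type} [Fintype σ] [DecidableEq σ] {w v : List σ}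
    (hw : w ≠ []) (hv : v ≠ []) (hwv : w.Perm v)
    (h : ∀ (t : σ) (x : σ → ℝ), fpoly w t x = fpoly v t x)
    (a : σ → Matrix (Fin 2) (Fin 2) TT) (ha : ∀ s, IsUT (a s)) {c : ℝ}
    (hc : (c : TT) ≤ evalWord a w 0 1) : (c : TT) ≤ evalWord a v 0 1 := by
  rw [(evalWord_apply a ha w hw).2.2.2] at hc
  rw [(evalWord_apply a ha v hv).2.2.2]
  obtain ⟨p, t, q, hpq, hc⟩ := hc
  obtain ⟨p', q', hv', hle⟩ := exists_split_of_fpoly_eq hwv (h t) (fun s => a s 0 0)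
    (fun s => a s 1 1) hpq
  refine ⟨p', t, q', hv', hc.trans ?_⟩
  rw [add_right_comm, add_right_comm _ (a t 0 1)]
  gcongr

/-- The assignment of upper triangular matrices whose evaluation on a word has
upper right entry `fpoly w t x`. -/
def fpolyAssign {σ : Type} [DecidableEq σ] (t : σ) (x : σ → ℝ) (s : σ) :
    Matrix (Fin 2) (Fin 2) TT :=
  !![(x s : TT), if s = t then 0 else ⊥; ⊥, 0]

theorem isUT_fpolyAssign {σ : Type} [DecidableEq σ] (t : σ) (x : σ → ℝ) (s : σ) :
    IsUT (fpolyAssign t x s) :=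
  isUT_two_iff.2 rfl

theorem evalWord_fpolyAssign {σ : Type} [Fintype σ] [DecidableEq σ] (t : σ) (x : σ → ℝ)
    {w : List σ} (hw : w ≠ []) : evalWord (fpolyAssign t x) w 0 1 = fpoly w t x := by
  refine WithBot.eq_of_forall_coe_le_iff fun c => ?_
  rw [(evalWord_apply _ (isUT_fpolyAssign t x) w hw).2.2.2, coe_le_fpoly_iff]
  have hx (p : List σ) : (p.map fun s => (x s : TT)).sum = ((p.map x).sum : ℝ) := by
    induction p with
    | nil => rfl
    | cons h p ih => simp [ih]
  constructor
  · rintro ⟨p, s, q, rfl, hc⟩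
    by_cases hs : s = t
    · subst hs
      exact ⟨p, q, rfl, by simpa [fpolyAssign, hx] using hc⟩
    · simp [fpolyAssign, hs] at hc
  · rintro ⟨p, q, rfl, hc⟩
    exact ⟨p, t, q, rfl, by simpa [fpolyAssign, hx] using hc⟩

/-- A semigroup identity `w = v` over a finite alphabet `Σ` holds in
`UT_2(𝕋)` iff `f_t^w(x) = f_t^v(x)` for all `t ∈ Σ` and all `x ∈ ℝ^Σ`. -/
theorem stmt_7 (σ : Type) [Fintype σ] [DecidableEq σ] (w v : List σ)
    (hw : w ≠ []) (hv : v ≠ []) :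
    (∀ a : σ → Matrix (Fin 2) (Fin 2) TT, (∀ s, IsUT (a s)) →
      evalWord a w = evalWord a v)
    ↔ (∀ (t : σ) (x : σ → ℝ), fpoly w t x = fpoly v t x) := by
  constructor
  · intro h t x
    rw [← evalWord_fpolyAssign t x hw, ← evalWord_fpolyAssign t x hv,
      h _ (isUT_fpolyAssign t x)]
  · intro h a ha
    have hwv : w.Perm v := List.perm_iff_count.2 fun t =>
      (count_le_of_fpoly_eq (h t)).antisymm (count_le_of_fpoly_eq fun x => (h t x).symm)
    obtain ⟨w00, w11, w10, -⟩ := evalWord_apply a ha w hw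
    obtain ⟨v00, v11, v10, -⟩ := evalWord_apply a ha v hv
    ext i j : 2
    fin_cases i <;> fin_cases j
    · exact w00.trans ((hwv.map _).sum_eq.trans v00.symm)
    · exact WithBot.eq_of_forall_coe_le_iff fun c =>
        ⟨coe_le_evalWord_of_fpoly_eq hw hv hwv h a ha,
          coe_le_evalWord_of_fpoly_eq hv hw hwv.symm (fun t x => (h t x).symm) a ha⟩
    · exact w10.trans v10.symm
    · exact w11.trans ((hwv.map _).sum_eq.trans v11.symm)
end

section
/- The map φ : ℬ_ℝ → UT_2(𝕋) sending (a, b) to the matrix with first row (a - b, a + b) and second row (-∞, b - a) is an injective semigroup homomorphism. -/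
/-- Multiplication of `ℬ_ℝ = ℝ × ℝ`: `(a,b)(c,d) = (a - b + max(b,c), d - c + max(b,c))`. -/
def bmulR (p q : ℝ × ℝ) : ℝ × ℝ :=
  (p.1 - p.2 + max p.2 q.1, q.2 - q.1 + max p.2 q.1)

/-- The map `ℬ_ℝ → UT_2(𝕋)` sending `(a, b)` to the matrix with rows `(a - b, a + b)` and
`(-∞, b - a)`. -/
def phiBR (p : ℝ × ℝ) : Matrix (Fin 2) (Fin 2) TT :=
  !![(((p.1 - p.2) : ℝ) : TT), (((p.1 + p.2) : ℝ) : TT); ⊥, (((p.2 - p.1) : ℝ) : TT)]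

/-- The map `φ : ℬ_ℝ → UT_2(𝕋)`, `(a,b) ↦ [[a-b, a+b], [-∞, b-a]]`,
is an injective semigroup homomorphism. -/
theorem stmt_10 :
    Function.Injective phiBR ∧ ∀ p q : ℝ × ℝ, phiBR (bmulR p q) = tmul (phiBR p) (phiBR q) := by
  refine ⟨fun p q h => ?_, fun p q => ?_⟩
  · have h₀ : p.1 - p.2 = q.1 - q.2 := WithBot.coe_injective (congrFun₂ h 0 0)
    have h₁ : p.1 + p.2 = q.1 + q.2 := WithBot.coe_injective (congrFun₂ h 0 1)
    exact Prod.ext (by linarith) (by linarith)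
  · ext i j
    fin_cases i <;> fin_cases j <;>
      simp [phiBR, bmulR, tmul, Fin.univ_succ, ← WithBot.coe_add, ← WithBot.coe_sup]
    · ring
    · rcases le_total p.2 q.1 with h | h
      · rw [max_eq_right h, max_eq_left (by linarith)]
        ring
      · rw [max_eq_left h, max_eq_right (by linarith)]
        ring
    · ring
end

section
/- Let φ : Σ⁺ → UT_n(𝕋) be a semigroup homomorphism and define x ∈ 𝕋^{Σ×{1,...,n}} by x(s, i) = φ(s)_{i,i}. Then for every word w ∈ Σ⁺ and all indices 1 ≤ i ≤ j ≤ n, φ(w)_{i,j} equals the maximum, over all words u ∈ Σ* with |u| ≤ n-1 and all strictly increasing sequences ρ = (i = ρ_0 < ρ_1 < ... < ρ_{|u|} = j) in {1,...,n}, of (Σ_{k=1}^{|u|} φ(u_k)_{ρ_{k-1},ρ_k}) + f_{u,ρ}^w(x). -/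
/-- `β_s^w(p,q)`: the number of (1-based) positions `i` of `w` with `p < i < q` carrying the
letter `s`. -/
def segCount {σ : Type} [DecidableEq σ] (w : List σ) (p q : ℕ) (s : σ) : ℕ :=
  ((w.drop p).take (q - p - 1)).count s

/-- The tropical polynomial function `f_{u,ρ}^w` associated to a word `w`, a word `u`
(of length `L`, given as `u : Fin L → σ`) and a sequence `ρ` of `L+1` indices:
the maximum, over all `0 = α₀ < α₁ < ⋯ < α_L < α_{L+1} = |w|+1` with `w_{α_k} = u_k`
(1-based indexing) for `k = 1, …, L`, of
`∑_{s ∈ Σ} ∑_{k=0}^{L} β_s^w(α_k, α_{k+1}) ⬝ x(s, ρ_k)`,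
with the maximum over the empty set equal to `-∞`, tropical powers being `ℕ`-scalar
multiples (`m • (-∞) = -∞` for `m > 0`, `0 • (-∞) = 0`). -/
def fupoly {σ : Type} [Fintype σ] [DecidableEq σ] (w : List σ) {L n : ℕ}
    (u : Fin L → σ) (ρ : Fin (L + 1) → Fin n) (x : σ → Fin n → TT) : TT :=
  (Finset.univ.filter (fun α : Fin (L + 2) → Fin (w.length + 2) =>
      (∀ p q, p < q → α p < α q) ∧ α 0 = 0 ∧ α (Fin.last (L + 1)) = Fin.last (w.length + 1) ∧
      ∀ k : Fin L, w[((α k.succ.castSucc : ℕ) - 1)]? = some (u k))).sup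
    (fun α => ∑ s : σ, ∑ k : Fin (L + 1),
      (segCount w (α k.castSucc : ℕ) (α k.succ : ℕ) s) • x s (ρ k))

/-- The tropical identity matrix. -/
def tropOne (ι : Type) [DecidableEq ι] : Matrix ι ι TT :=
  fun i j => if i = j then 0 else ⊥

theorem tropOne_tmul {ι : Type} [Fintype ι] [DecidableEq ι] (A : Matrix ι ι TT) :
    tmul (tropOne ι) A = A := by
  funext i j
  refine le_antisymm (Finset.sup_le fun k _ => ?_) ?_
  · by_cases h : i = k <;> simp [tropOne, h]
  · exact le_trans (by simp [tropOne])
      (Finset.le_sup (f := fun k => tropOne ι i k + A k j) (Finset.mem_univ i))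

/-- The tropical identity matrix multiplied on the right by the letters of a word. -/
def evalWordOne {ι σ : Type} [Fintype ι] [DecidableEq ι] (a : σ → Matrix ι ι TT) (w : List σ) :
    Matrix ι ι TT :=
  w.foldl (fun M s => tmul M (a s)) (tropOne ι)

theorem evalWord_eq_evalWordOne {ι σ : Type} [Fintype ι] [DecidableEq ι]
    (a : σ → Matrix ι ι TT) {w : List σ} (hw : w ≠ []) : evalWord a w = evalWordOne a w := by
  cases w with
  | nil => exact absurd rfl hw
  | cons h t => simp [evalWord, evalWordOne, tropOne_tmul]

theorem evalWordOne_append_singleton {ι σ : Type} [Fintype ι] [DecidableEq ι]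
    (a : σ → Matrix ι ι TT) (w : List σ) (s : σ) :
    evalWordOne a (w ++ [s]) = tmul (evalWordOne a w) (a s) := by
  simp [evalWordOne]

/-- The sum of `y` over the letters of `w` at 1-based positions strictly between `p` and `q`. -/
def segSum {σ : Type} (w : List σ) (y : σ → TT) (p q : ℕ) : TT :=
  (((w.drop p).take (q - p - 1)).map y).sum

theorem segSum_eq_sum_segCount {σ : Type} [Fintype σ] [DecidableEq σ] (w : List σ) (y : σ → TT)
    (p q : ℕ) : segSum w y p q = ∑ s, segCount w p q s • y s := by
  rw [segSum, Finset.sum_list_map_count]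
  refine Finset.sum_subset (Finset.subset_univ _) fun s _ hs => ?_
  rw [List.count_eq_zero_of_not_mem (by simpa using hs), zero_smul]

theorem segSum_append_of_le {σ : Type} (w : List σ) (s : σ) (y : σ → TT) {p q : ℕ}
    (hpq : p < q) (hq : q ≤ w.length + 1) : segSum (w ++ [s]) y p q = segSum w y p q := by
  rw [segSum, segSum, List.drop_append_of_le_length (by omega),
    List.take_append_of_le_length (by simp; omega)]

theorem segSum_append_full {σ : Type} (w : List σ) (s : σ) (y : σ → TT) {p : ℕ}
    (hp : p ≤ w.length) :
    segSum (w ++ [s]) y p (w.length + 2) = segSum w y p (w.length + 1) + y s := by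
  rw [segSum, segSum, List.drop_append_of_le_length hp, List.take_of_length_le (by simp; omega),
    List.take_of_length_le (by simp; omega)]
  simp

theorem segSum_succ {σ : Type} (w : List σ) (y : σ → TT) (p : ℕ) : segSum w y p (p + 1) = 0 := by
  simp [segSum]

/-- `α` lists positions `0 = α₀ < α₁ < ⋯ < α_L < α_{L+1} = |w| + 1` at which `w` reads `u`. -/
structure IsOccurrence {σ : Type} (w : List σ) (L : ℕ) (u : ℕ → σ) (α : ℕ → ℕ) : Prop where
  lt : ∀ p q, p < q → q ≤ L + 1 → α p < α q
  zero : α 0 = 0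
  last : α (L + 1) = w.length + 1
  letter : ∀ k < L, w[α (k + 1) - 1]? = some (u k)

/-- The weight of the path which follows the vertices `ρ₀, …, ρ_L`, moving from `ρ_k` to `ρ_{k+1}`
while reading the letter `u_k` of `w` at position `α_{k+1}`. -/
def pathWeight {ι σ : Type} (a : σ → Matrix ι ι TT) (w : List σ) (L : ℕ) (u : ℕ → σ) (ρ : ℕ → ι)
    (α : ℕ → ℕ) : TT :=
  ∑ k ∈ Finset.range L, a (u k) (ρ k) (ρ (k + 1)) +
    ∑ k ∈ Finset.range (L + 1), segSum w (fun s => a s (ρ k) (ρ k)) (α k) (α (k + 1))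

theorem pathWeight_append_stay {ι σ : Type} (a : σ → Matrix ι ι TT) {w : List σ} {L : ℕ}
    {u : ℕ → σ} {α β : ℕ → ℕ} (ρ : ℕ → ι) (s : σ) (hα : IsOccurrence w L u α)
    (hβ : ∀ k ≤ L, β k = α k) (hβL : β (L + 1) = w.length + 2) :
    pathWeight a (w ++ [s]) L u ρ β = pathWeight a w L u ρ α + a s (ρ L) (ρ L) := by
  have hL := hα.lt L (L + 1) (by omega) le_rfl
  have hlast := hα.last
  rw [pathWeight, pathWeight, Finset.sum_range_succ _ L, Finset.sum_range_succ _ L, hβL,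
    hβ L le_rfl, segSum_append_full _ _ _ (by omega), hα.last, add_assoc, add_assoc]
  congr 2
  refine Finset.sum_congr rfl fun k hk => ?_
  rw [Finset.mem_range] at hk
  have h1 := hα.lt k (k + 1) (by omega) (by omega)
  have h2 := hα.lt (k + 1) (L + 1) (by omega) le_rfl
  rw [hβ k (by omega), hβ (k + 1) (by omega), segSum_append_of_le _ _ _ h1 (by omega)]

theorem pathWeight_append_move {ι σ : Type} (a : σ → Matrix ι ι TT) {w : List σ} {L : ℕ}
    {u v : ℕ → σ} {α β : ℕ → ℕ} {ρ τ : ℕ → ι} {s : σ} (hα : IsOccurrence w L u α)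
    (hβ : ∀ k ≤ L + 1, β k = α k) (hβL : β (L + 2) = w.length + 2)
    (hτ : ∀ k ≤ L, τ k = ρ k) (hv : ∀ k < L, v k = u k) (hvL : v L = s) :
    pathWeight a (w ++ [s]) (L + 1) v τ β = pathWeight a w L u ρ α + a s (ρ L) (τ (L + 1)) := by
  rw [pathWeight, pathWeight, Finset.sum_range_succ _ L, Finset.sum_range_succ _ (L + 1), hβL,
    hβ (L + 1) le_rfl, hα.last, segSum_succ, add_zero, hvL, hτ L le_rfl, add_right_comm]
  congr 2
  · refine Finset.sum_congr rfl fun k hk => ?_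
    rw [Finset.mem_range] at hk
    rw [hv k hk, hτ k (by omega), hτ (k + 1) (by omega)]
  · refine Finset.sum_congr rfl fun k hk => ?_
    rw [Finset.mem_range] at hk
    have h1 := hα.lt k (k + 1) (by omega) (by omega)
    have h2 : α (k + 1) ≤ α (L + 1) := by
      rcases Nat.lt_or_ge k L with h | h
      · exact (hα.lt _ _ (by omega) le_rfl).le
      · rw [show k = L by omega]
    rw [hα.last] at h2
    rw [hβ k (by omega), hβ (k + 1) (by omega), hτ k (by omega), segSum_append_of_le _ _ _ h1 h2]

theorem pathWeight_le_evalWordOne {ι σ : Type} [Fintype ι] [DecidableEq ι]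
    (a : σ → Matrix ι ι TT) (ρ : ℕ → ι) (u : ℕ → σ) (w : List σ) :
    ∀ (L : ℕ) (α : ℕ → ℕ), IsOccurrence w L u α →
      pathWeight a w L u ρ α ≤ evalWordOne a w (ρ 0) (ρ L) := by
  induction w using List.reverseRecOn with
  | nil =>
    intro L α hα
    obtain rfl : L = 0 := by
      by_contra hL
      have h1 := hα.lt 0 1 (by omega) (by omega)
      have h2 := hα.lt 1 (L + 1) (by omega) le_rfl
      have h3 := hα.last
      simp at h3
      omega
    simp [pathWeight, segSum, evalWordOne, tropOne]
  | append_singleton w s ih =>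
    intro L α hα
    have hlt := hα.lt L (L + 1) (by omega) le_rfl
    have hlast : α (L + 1) = w.length + 2 := by simpa using hα.last
    have hbound : ∀ k < L, α (k + 1) ≤ α L := fun k hk => by
      rcases Nat.lt_or_ge (k + 1) L with h | h
      · exact (hα.lt _ _ h (by omega)).le
      · rw [show k + 1 = L by omega]
    have hpos : ∀ k < L, 0 < α (k + 1) := fun k hk => by
      have := hα.lt 0 (k + 1) (by omega) (by omega)
      omega
    have hletter : ∀ k < L, α (k + 1) ≤ w.length → w[α (k + 1) - 1]? = some (u k) :=
      fun k hk h => by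
        have h1 := hα.letter k hk
        have h2 := hpos k hk
        rwa [List.getElem?_append_left (by omega)] at h1
    rw [evalWordOne_append_singleton]
    rcases Nat.lt_or_ge w.length (α L) with hL | hL
    · obtain ⟨K, rfl⟩ : ∃ K, L = K + 1 := by
        rcases L with _ | K
        · rw [hα.zero] at hL
          omega
        · exact ⟨K, rfl⟩
      have hK : α (K + 1) = w.length + 1 := by omega
      have hocc : IsOccurrence w K u α := by
        refine ⟨fun p q h h' => hα.lt p q h (by omega), hα.zero, hK, fun k hk => ?_⟩
        have := hα.lt (k + 1) (K + 1) (by omega) (by omega)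
        exact hletter k (by omega) (by omega)
      have hs : u K = s := by
        have := hα.letter K (by omega)
        rw [hK] at this
        simpa using this.symm
      rw [pathWeight_append_move a (ρ := ρ) hocc (fun _ _ => rfl) hlast (fun _ _ => rfl)
        (fun _ _ => rfl) hs]
      exact (add_le_add_left (ih K α hocc) _).trans
        (Finset.le_sup (f := fun k => evalWordOne a w (ρ 0) k + a s k (ρ (K + 1)))
          (Finset.mem_univ _))
    · have hne : ∀ k ≤ L, Function.update α (L + 1) (w.length + 1) k = α k := fun k hk =>
        Function.update_of_ne (by omega) _ _
      have hocc : IsOccurrence w L u (Function.update α (L + 1) (w.length + 1)) := by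
        refine ⟨fun p q h h' => ?_, ?_, by simp, fun k hk => ?_⟩
        · rw [hne p (by omega)]
          rcases Nat.lt_or_ge L q with hq | hq
          · obtain rfl : q = L + 1 := by omega
            rw [Function.update_self]
            rcases Nat.lt_or_ge p L with hp | hp
            · have := hα.lt p L hp (by omega)
              omega
            · rw [show p = L by omega]
              omega
          · rw [hne q hq]
            exact hα.lt p q h h'
        · rw [hne 0 (by omega), hα.zero]
        · rw [hne (k + 1) (by omega)]
          have := hbound k hk
          exact hletter k hk (by omega)
      rw [pathWeight_append_stay a ρ s hocc (fun k hk => (hne k hk).symm) hlast]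
      exact (add_le_add_left (ih L _ hocc) _).trans
        (Finset.le_sup (f := fun k => evalWordOne a w (ρ 0) k + a s k (ρ L)) (Finset.mem_univ _))

theorem exists_evalWordOne_eq_pathWeight {n : ℕ} {σ : Type} [Nonempty σ]
    (a : σ → Matrix (Fin n) (Fin n) TT) (ha : ∀ s, IsUT (a s)) (w : List σ) (i : Fin n) :
    ∀ j, evalWordOne a w i j ≠ ⊥ → ∃ (L : ℕ) (u : ℕ → σ) (ρ : ℕ → Fin n) (α : ℕ → ℕ),
      IsOccurrence w L u α ∧ (∀ p q, p < q → q ≤ L → ρ p < ρ q) ∧ ρ 0 = i ∧ ρ L = j ∧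
        evalWordOne a w i j = pathWeight a w L u ρ α := by
  induction w using List.reverseRecOn with
  | nil =>
    intro j hj
    have hij : i = j := by
      by_contra h
      simp [evalWordOne, tropOne, h] at hj
    refine ⟨0, fun _ => Classical.arbitrary σ, fun _ => i, id, ⟨?_, rfl, rfl, ?_⟩, ?_, rfl, hij, ?_⟩
    · exact fun p q h _ => h
    · omega
    · omega
    · simp [pathWeight, segSum, evalWordOne, tropOne, hij]
  | append_singleton w s ih =>
    intro j hj
    rw [evalWordOne_append_singleton] at hj ⊢
    obtain ⟨k, -, hk⟩ := Finset.exists_mem_eq_sup Finset.univ ⟨i, Finset.mem_univ i⟩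
      (fun k => evalWordOne a w i k + a s k j)
    change tmul (evalWordOne a w) (a s) i j = evalWordOne a w i k + a s k j at hk
    rw [hk] at hj ⊢
    obtain ⟨hik, hkj⟩ := WithBot.add_ne_bot.1 hj
    obtain ⟨L, u, ρ, α, hα, hρ, h0, hL, hV⟩ := ih k hik
    have hlast := hα.last
    have hpos : ∀ k < L, 0 < α (k + 1) ∧ α (k + 1) ≤ w.length := fun k hk => by
      have h1 := hα.lt 0 (k + 1) (by omega) (by omega)
      have h2 := hα.lt (k + 1) (L + 1) (by omega) (by omega)
      omega
    have hletter : ∀ k < L, (w ++ [s])[α (k + 1) - 1]? = some (u k) := fun k hk => by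
      have := hpos k hk
      rw [List.getElem?_append_left (by omega)]
      exact hα.letter k hk
    rcases (not_lt.1 fun h => hkj (ha s k j h) : k ≤ j).eq_or_lt with rfl | hlt
    · have hne : ∀ k ≤ L, Function.update α (L + 1) (w.length + 2) k = α k := fun k hk =>
        Function.update_of_ne (by omega) _ _
      refine ⟨L, u, ρ, Function.update α (L + 1) (w.length + 2), ⟨fun p q h h' => ?_, ?_, by simp,
        fun k hk => ?_⟩, hρ, h0, hL, ?_⟩
      · rw [hne p (by omega)]
        have := hα.lt p q h h'
        rcases Nat.lt_or_ge L q with hq | hq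
        · obtain rfl : q = L + 1 := by omega
          rw [Function.update_self]
          omega
        · rwa [hne q hq]
      · rw [hne 0 (by omega), hα.zero]
      · rw [hne (k + 1) (by omega)]
        exact hletter k hk
      · rw [pathWeight_append_stay a ρ s hα hne (Function.update_self ..), hV, hL]
    · have hne : ∀ k ≤ L + 1, Function.update α (L + 2) (w.length + 2) k = α k := fun k hk =>
        Function.update_of_ne (by omega) _ _
      have hρne : ∀ k ≤ L, Function.update ρ (L + 1) j k = ρ k := fun k hk =>
        Function.update_of_ne (by omega) _ _
      have hune : ∀ k < L, Function.update u L s k = u k := fun k hk =>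
        Function.update_of_ne (by omega) _ _
      refine ⟨L + 1, Function.update u L s, Function.update ρ (L + 1) j,
        Function.update α (L + 2) (w.length + 2), ⟨fun p q h h' => ?_, ?_, by simp, fun k hk => ?_⟩,
        fun p q h h' => ?_, ?_, by simp, ?_⟩
      · rw [hne p (by omega)]
        rcases Nat.lt_or_ge (L + 1) q with hq | hq
        · obtain rfl : q = L + 2 := by omega
          rw [Function.update_self]
          rcases Nat.lt_or_ge p (L + 1) with hp | hp
          · have := hα.lt p (L + 1) hp le_rfl
            omega
          · rw [show p = L + 1 by omega]
            omega
        · rw [hne q hq]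
          exact hα.lt p q h hq
      · rw [hne 0 (by omega), hα.zero]
      · rw [hne (k + 1) (by omega)]
        rcases Nat.lt_or_ge k L with hkL | hkL
        · rw [hune k hkL]
          exact hletter k hkL
        · obtain rfl : k = L := by omega
          rw [hlast]
          simp
      · rw [hρne p (by omega)]
        rcases Nat.lt_or_ge L q with hq | hq
        · obtain rfl : q = L + 1 := by omega
          rw [Function.update_self]
          rcases Nat.lt_or_ge p L with hp | hp
          · exact ((hρ p L hp le_rfl).trans_eq hL).trans hlt
          · rwa [show p = L by omega, hL]
        · rw [hρne q hq]
          exact hρ p q h hq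
      · rw [hρne 0 (by omega), h0]
      · rw [pathWeight_append_move a hα hne (Function.update_self ..) hρne hune
          (Function.update_self ..), hV, hL, Function.update_self]

theorem pathWeight_eq_sum_fin {n : ℕ} {σ : Type} [Fintype σ] [DecidableEq σ]
    (a : σ → Matrix (Fin n) (Fin n) TT) (w : List σ) (L : ℕ) (u : ℕ → σ) (ρ : ℕ → Fin n)
    (α : ℕ → ℕ) :
    pathWeight a w L u ρ α =
      ∑ k : Fin L, a (u k) (ρ k) (ρ (k + 1)) +
        ∑ s : σ, ∑ k : Fin (L + 1), segCount w (α k) (α (k + 1)) s • a s (ρ k) (ρ k) := by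
  rw [pathWeight, Finset.sum_range, Finset.sum_range, Finset.sum_comm]
  simp only [segSum_eq_sum_segCount]

theorem add_sup_le {β : Type} {S : Finset β} {f : β → TT} {b c : TT}
    (h : ∀ x ∈ S, c + f x ≤ b) : c + S.sup f ≤ b := by
  rcases S.eq_empty_or_nonempty with rfl | hne
  · simp
  · obtain ⟨x, hx, hsup⟩ := Finset.exists_mem_eq_sup S hne f
    rw [hsup]
    exact h x hx

theorem sum_add_fupoly_le_evalWordOne {n : ℕ} {σ : Type} [Fintype σ] [DecidableEq σ] [Nonempty σ]
    (a : σ → Matrix (Fin n) (Fin n) TT) (w : List σ) {L : ℕ} (u : Fin L → σ)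
    (ρ : Fin (L + 1) → Fin n) :
    (∑ k : Fin L, a (u k) (ρ k.castSucc) (ρ k.succ)) + fupoly w u ρ (fun s p => a s p p) ≤
      evalWordOne a w (ρ 0) (ρ (Fin.last L)) := by
  refine add_sup_le fun α hα => ?_
  obtain ⟨hlt, h0, hlast, hu⟩ := (Finset.mem_filter.1 hα).2
  let u' : ℕ → σ := fun k => if h : k < L then u ⟨k, h⟩ else Classical.arbitrary σ
  let ρ' : ℕ → Fin n := fun k => ρ (Fin.ofNat (L + 1) k)
  let α' : ℕ → ℕ := fun k => α (Fin.ofNat (L + 2) k)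
  have hρ' : ∀ k : Fin (L + 1), ρ' k = ρ k := fun k => by simp [ρ']
  have hα' : ∀ k : Fin (L + 2), α' k = α k := fun k => by simp [α']
  have hu' : ∀ k : Fin L, u' k = u k := fun k => by simp [u']
  have hocc : IsOccurrence w L u' α' := by
    refine ⟨fun p q h h' => ?_, ?_, ?_, fun k hk => ?_⟩
    · have := hlt ⟨p, by omega⟩ ⟨q, by omega⟩ h
      rw [Fin.lt_def, ← hα', ← hα'] at this
      exact this
    · simpa [h0] using hα' 0
    · simpa [hlast] using hα' (Fin.last (L + 1))
    · have := hu ⟨k, hk⟩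
      rw [← hα', ← hu'] at this
      exact this
  have key := pathWeight_le_evalWordOne a ρ' u' w L α' hocc
  rw [pathWeight_eq_sum_fin] at key
  have e0 : ρ' 0 = ρ 0 := hρ' 0
  have eL : ρ' L = ρ (Fin.last L) := hρ' (Fin.last L)
  rw [e0, eL] at key
  refine le_of_eq_of_le ?_ key
  congr 1
  · refine Finset.sum_congr rfl fun k _ => ?_
    rw [← hu', ← hρ', ← hρ']
    rfl
  · refine Finset.sum_congr rfl fun s _ => Finset.sum_congr rfl fun k _ => ?_
    rw [← hα', ← hα', ← hρ']
    rfl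

theorem pathWeight_le_sum_add_fupoly {n : ℕ} {σ : Type} [Fintype σ] [DecidableEq σ]
    (a : σ → Matrix (Fin n) (Fin n) TT) {w : List σ} {L : ℕ} {u : ℕ → σ} (ρ : ℕ → Fin n)
    {α : ℕ → ℕ} (hα : IsOccurrence w L u α) :
    pathWeight a w L u ρ α ≤ (∑ k : Fin L, a (u k) (ρ k) (ρ (k + 1))) +
      fupoly w (fun k : Fin L => u k) (fun k : Fin (L + 1) => ρ k) (fun s p => a s p p) := by
  have hbound : ∀ k : Fin (L + 2), α k < w.length + 2 := fun k => by
    have hlast := hα.last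
    rcases Nat.lt_or_ge k (L + 1) with h | h
    · have := hα.lt k (L + 1) h le_rfl
      omega
    · rw [show (k : ℕ) = L + 1 by omega]
      omega
  rw [pathWeight_eq_sum_fin]
  refine add_le_add_right ?_ _
  rw [fupoly]
  refine Finset.le_sup (f := fun α : Fin (L + 2) → Fin (w.length + 2) =>
    ∑ s : σ, ∑ k : Fin (L + 1), (segCount w (α k.castSucc : ℕ) (α k.succ : ℕ) s) •
      a s (ρ k) (ρ k)) (b := fun k => ⟨α k, hbound k⟩) ?_
  refine Finset.mem_filter.2 ⟨Finset.mem_univ _, fun p q h => ?_, ?_, ?_, fun k => ?_⟩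
  · exact hα.lt p q h (by omega)
  · exact Fin.ext hα.zero
  · exact Fin.ext hα.last
  · exact hα.letter k k.2

/-- Let `φ : Σ⁺ → UT_n(𝕋)` be the semigroup homomorphism determined by the
letter assignment `a`, and set `x(s,i) = φ(s)_{i,i}`. Then for every word `w ∈ Σ⁺` and all
indices `i ≤ j`, `φ(w)_{i,j}` is the maximum, over all words `u` of length `L ≤ n-1` and all
strictly increasing sequences `ρ : i = ρ₀ < ρ₁ < ⋯ < ρ_L = j`, of
`(∑_{k=1}^{L} φ(u_k)_{ρ_{k-1}, ρ_k}) + f_{u,ρ}^w(x)`. -/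
theorem stmt_13 (n : ℕ) (σ : Type) [Fintype σ] [DecidableEq σ]
    (a : σ → Matrix (Fin n) (Fin n) TT) (ha : ∀ s, IsUT (a s))
    (w : List σ) (hw : w ≠ []) (i j : Fin n) (hij : i ≤ j) :
    evalWord a w i j =
      (Finset.univ : Finset (Σ L : Fin n, (Fin (L : ℕ) → σ) × (Fin ((L : ℕ) + 1) → Fin n))).sup
        (fun d =>
          if (∀ p q, p < q → d.2.2 p < d.2.2 q) ∧ d.2.2 0 = i ∧ d.2.2 (Fin.last (d.1 : ℕ)) = j
          then (∑ k : Fin (d.1 : ℕ), a (d.2.1 k) (d.2.2 k.castSucc) (d.2.2 k.succ))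
                + fupoly w d.2.1 d.2.2 (fun s p => a s p p)
          else ⊥) := by
  have : Nonempty σ := ⟨w.head hw⟩
  rw [evalWord_eq_evalWordOne a hw]
  refine le_antisymm ?_ (Finset.sup_le fun d _ => ?_)
  · by_cases hbot : evalWordOne a w i j = ⊥
    · rw [hbot]
      exact bot_le
    obtain ⟨L, u, ρ, α, hα, hρ, h0, hL, hV⟩ := exists_evalWordOne_eq_pathWeight a ha w i j hbot
    have hmono : StrictMono fun k : Fin (L + 1) => ρ k := fun p q h => hρ p q h (by omega)
    have hLn : L < n := by simpa using Fintype.card_le_of_injective _ hmono.injective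
    rw [hV]
    refine (pathWeight_le_sum_add_fupoly a ρ hα).trans ?_
    refine le_of_eq_of_le ?_ (Finset.le_sup (Finset.mem_univ
      (⟨⟨L, hLn⟩, fun k => u k, fun k => ρ k⟩ :
        Σ L : Fin n, (Fin (L : ℕ) → σ) × (Fin ((L : ℕ) + 1) → Fin n))))
    exact (if_pos ⟨fun _ _ h => hmono h, h0, hL⟩).symm
  · split_ifs with h
    · obtain ⟨-, h0, hL⟩ := h
      simpa only [h0, hL] using sum_add_fupoly_le_evalWordOne a w d.2.1 d.2.2
    · exact bot_le
end

section
/- A semigroup identity w = v over a finite alphabet Σ holds in UT_n(𝕋) if and only if for every word u ∈ Σ* with |u| ≤ n-1 and every strictly increasing sequence ρ = (ρ_0 < ρ_1 < ... < ρ_{|u|}) in {1,...,n}, the functions f_{u,ρ}^w and f_{u,ρ}^v agree at every x ∈ ℝ^{Σ×{1,...,n}}. -/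
section Cuts

variable {σ : Type}

/-- `α` lists the positions `0 = α₀ < ⋯ < α_{L+1} = |w| + 1`, the inner ones carrying the letters
of `u`. -/
def IsCut (w : List σ) {L : ℕ} (u : Fin L → σ) (α : Fin (L + 2) → ℕ) : Prop :=
  StrictMono α ∧ α 0 = 0 ∧ α (Fin.last (L + 1)) = w.length + 1 ∧
    ∀ k : Fin L, w[α k.succ.castSucc - 1]? = some (u k)

theorem IsCut.one_le_succ {w : List σ} {L : ℕ} {u : Fin L → σ} {α : Fin (L + 2) → ℕ}
    (h : IsCut w u α) (k : Fin (L + 1)) : 1 ≤ α k.succ := by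
  have := h.1 (Fin.succ_pos k)
  omega

theorem IsCut.cons_skip {t : List σ} {L : ℕ} {u : Fin L → σ} {α : Fin (L + 2) → ℕ}
    (h : IsCut t u α) (s : σ) : IsCut (s :: t) u (Fin.cons 0 fun k => α k.succ + 1) := by
  have h1 := h.one_le_succ
  obtain ⟨hα, h0, hl, hu⟩ := h
  refine ⟨?_, rfl, ?_, fun k => ?_⟩
  · intro p q
    cases p using Fin.cases <;> cases q using Fin.cases <;> simp [hα.lt_iff_lt]
  · rw [← Fin.succ_last, Fin.cons_succ, Fin.succ_last, hl]
    rfl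
  · rw [← Fin.succ_castSucc, Fin.cons_succ, ← hu k, ← Fin.succ_castSucc]
    obtain ⟨m, hm⟩ := Nat.exists_eq_add_of_le' (h1 k.castSucc)
    rw [hm]
    simp

theorem IsCut.cons_take {t : List σ} {L : ℕ} {u : Fin (L + 1) → σ} {α : Fin (L + 2) → ℕ}
    (h : IsCut t (Fin.tail u) α) : IsCut (u 0 :: t) u (Fin.cons 0 fun k => α k + 1) := by
  have h1 := h.one_le_succ
  obtain ⟨hα, h0, hl, hu⟩ := h
  refine ⟨?_, rfl, ?_, fun k => ?_⟩
  · intro p q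
    cases p using Fin.cases <;> cases q using Fin.cases <;> simp [hα.lt_iff_lt]
  · rw [← Fin.succ_last, Fin.cons_succ, hl]
    rfl
  · rw [← Fin.succ_castSucc, Fin.cons_succ]
    cases k using Fin.cases with
    | zero => simp [h0]
    | succ k =>
      have := hu k
      rw [← Fin.succ_castSucc] at this ⊢
      obtain ⟨m, hm⟩ := Nat.exists_eq_add_of_le' (h1 k.castSucc)
      rw [hm] at this ⊢
      simpa [Fin.tail] using this

theorem IsCut.exists_cons {s : σ} {t : List σ} {L : ℕ} {u : Fin L → σ} {α : Fin (L + 2) → ℕ}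
    (h : IsCut (s :: t) u α) (h1 : α 1 ≠ 1) :
    ∃ β, IsCut t u β ∧ α = Fin.cons 0 fun k => β k.succ + 1 := by
  have h2 : ∀ k : Fin (L + 1), 2 ≤ α k.succ := fun k => by
    have ha := h.one_le_succ 0
    have hb := h.1.monotone (Fin.succ_le_succ_iff.2 (Fin.zero_le k))
    rw [Fin.succ_zero_eq_one] at ha hb
    omega
  obtain ⟨hα, h0, hl, hu⟩ := h
  refine ⟨fun k => α k - 1, ⟨?_, by simp [h0], by simp [hl], fun k => ?_⟩, ?_⟩
  · intro p q hpq
    have := hα hpq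
    cases q using Fin.cases with
    | zero => simp at hpq
    | succ q =>
      have := h2 q
      change α p - 1 < α q.succ - 1
      omega
  · have := hu k
    rw [← Fin.succ_castSucc] at this ⊢
    obtain ⟨m, hm⟩ := Nat.exists_eq_add_of_le' (h2 k.castSucc)
    simp only [hm] at this ⊢
    simpa using this
  · funext k
    cases k using Fin.cases with
    | zero => simpa using h0
    | succ k =>
      have := h2 k
      simp only [Fin.cons_succ]
      omega

theorem IsCut.exists_tail {s : σ} {t : List σ} {L : ℕ} {u : Fin (L + 1) → σ}
    {α : Fin (L + 3) → ℕ} (h : IsCut (s :: t) u α) (h1 : α 1 = 1) :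
    u 0 = s ∧ ∃ β, IsCut t (Fin.tail u) β ∧ α = Fin.cons 0 fun k => β k + 1 := by
  have h2 := h.one_le_succ
  obtain ⟨hα, h0, hl, hu⟩ := h
  have hz : (Fin.succ (0 : Fin (L + 1))).castSucc = (1 : Fin (L + 3)) := rfl
  refine ⟨?_, fun k => α k.succ - 1, ⟨?_, by simp [h1], by simp [hl], fun k => ?_⟩,
    ?_⟩
  · have := hu 0
    rw [hz, h1] at this
    simpa using this.symm
  · intro p q hpq
    have := hα (Fin.succ_lt_succ_iff.2 hpq)
    have := h2 p
    change α p.succ - 1 < α q.succ - 1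
    omega
  · have := hu k.succ
    have h3 : 2 ≤ α k.succ.succ.castSucc := by
      have : (1 : Fin (L + 3)) < k.succ.succ.castSucc := by simp [Fin.lt_def]
      have := hα this
      omega
    obtain ⟨m, hm⟩ := Nat.exists_eq_add_of_le' h3
    rw [← Fin.succ_castSucc] at hm this
    simp only [hm] at this ⊢
    simpa [Fin.tail] using this
  · funext k
    cases k using Fin.cases with
    | zero => simpa using h0
    | succ k =>
      have := h2 k
      simp only [Fin.cons_succ]
      omega

variable [DecidableEq σ]

theorem segCount_cons_succ_succ (s : σ) (t : List σ) (p q : ℕ) (r : σ) :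
    segCount (s :: t) (p + 1) (q + 1) r = segCount t p q r := by
  simp [segCount]

theorem segCount_cons_zero (s : σ) (t : List σ) {q : ℕ} (hq : 1 ≤ q) (r : σ) :
    segCount (s :: t) 0 (q + 1) r = (if s = r then 1 else 0) + segCount t 0 q r := by
  obtain ⟨q, rfl⟩ := Nat.exists_eq_add_of_le' hq
  simp [segCount, List.count_cons, add_comm]

variable [Fintype σ] {n : ℕ}

/-- The monomial of `fupoly` attached to the positions `α`. -/
def cutMonomial (w : List σ) {L : ℕ} (α : Fin (L + 2) → ℕ) (ρ : Fin (L + 1) → Fin n)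
    (x : σ → Fin n → TT) : TT :=
  ∑ s : σ, ∑ k : Fin (L + 1), segCount w (α k.castSucc) (α k.succ) s • x s (ρ k)

theorem fupoly_le_iff (w : List σ) {L : ℕ} (u : Fin L → σ) (ρ : Fin (L + 1) → Fin n)
    (x : σ → Fin n → TT) (c : TT) :
    fupoly w u ρ x ≤ c ↔ ∀ α, IsCut w u α → cutMonomial w α ρ x ≤ c := by
  unfold fupoly
  rw [Finset.sup_le_iff]
  constructor
  · rintro h α ⟨hα, h0, hl, hu⟩
    have hlt : ∀ k, α k < w.length + 2 := fun k => by
      have := hα.monotone (Fin.le_last k)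
      omega
    refine h (fun k => ⟨α k, hlt k⟩) ?_
    simp only [Finset.mem_filter, Finset.mem_univ, true_and]
    exact ⟨fun p q hpq => hα hpq, Fin.ext h0, Fin.ext hl, hu⟩
  · intro h α hα
    simp only [Finset.mem_filter, Finset.mem_univ, true_and] at hα
    obtain ⟨hα, h0, hl, hu⟩ := hα
    refine h (fun k => (α k : ℕ)) ⟨fun p q hpq => hα p q hpq, ?_, ?_, hu⟩
    · simp [h0]
    · simp [hl]

theorem cutMonomial_le_fupoly {w : List σ} {L : ℕ} {u : Fin L → σ}
    {α : Fin (L + 2) → ℕ} (hα : IsCut w u α) (ρ : Fin (L + 1) → Fin n) (x : σ → Fin n → TT) :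
    cutMonomial w α ρ x ≤ fupoly w u ρ x :=
  (fupoly_le_iff w u ρ x _).1 le_rfl α hα

theorem cutMonomial_cons_skip (s : σ) (t : List σ) {L : ℕ} (α : Fin (L + 2) → ℕ)
    (h0 : α 0 = 0) (hα : ∀ k : Fin (L + 1), 1 ≤ α k.succ) (ρ : Fin (L + 1) → Fin n)
    (x : σ → Fin n → TT) :
    cutMonomial (s :: t) (Fin.cons 0 fun k => α k.succ + 1) ρ x
      = x s (ρ 0) + cutMonomial t α ρ x := by
  have key : ∀ r : σ, ∑ k : Fin (L + 1), segCount (s :: t)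
        ((Fin.cons 0 fun k => α k.succ + 1 : Fin (L + 2) → ℕ) k.castSucc)
        ((Fin.cons 0 fun k => α k.succ + 1 : Fin (L + 2) → ℕ) k.succ) r • x r (ρ k)
      = (if s = r then x r (ρ 0) else 0)
        + ∑ k : Fin (L + 1), segCount t (α k.castSucc) (α k.succ) r • x r (ρ k) := by
    intro r
    rw [Fin.sum_univ_succ, Fin.sum_univ_succ, ← add_assoc]
    congr 1
    · simp only [Fin.castSucc_zero, Fin.cons_zero, Fin.cons_succ, h0]
      rw [segCount_cons_zero s t (hα 0), add_nsmul]
      split_ifs <;> simp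
    · refine Finset.sum_congr rfl fun k _ => ?_
      rw [← Fin.succ_castSucc]
      simp only [Fin.cons_succ, segCount_cons_succ_succ]
  simp only [cutMonomial, key, Finset.sum_add_distrib]
  simp

theorem cutMonomial_cons_take (s : σ) (t : List σ) {L : ℕ} (α : Fin (L + 2) → ℕ)
    (h0 : α 0 = 0) (ρ : Fin (L + 2) → Fin n) (x : σ → Fin n → TT) :
    cutMonomial (s :: t) (Fin.cons 0 fun k => α k + 1) ρ x
      = cutMonomial t α (Fin.tail ρ) x := by
  unfold cutMonomial
  refine Finset.sum_congr rfl fun r _ => ?_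
  rw [Fin.sum_univ_succ]
  have : segCount (s :: t) ((Fin.cons 0 fun k => α k + 1 : Fin (L + 3) → ℕ) (Fin.castSucc 0))
      ((Fin.cons 0 fun k => α k + 1 : Fin (L + 3) → ℕ) (Fin.succ 0)) r = 0 := by
    simp only [Fin.castSucc_zero, Fin.cons_zero, Fin.cons_succ, h0]
    simp [segCount]
  rw [this, zero_nsmul, zero_add]
  refine Finset.sum_congr rfl fun k _ => ?_
  rw [← Fin.succ_castSucc]
  simp only [Fin.cons_succ, segCount_cons_succ_succ]
  rfl

theorem fupoly_nil_zero (u : Fin 0 → σ) (ρ : Fin 1 → Fin n) (x : σ → Fin n → TT) :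
    fupoly [] u ρ x = 0 := by
  have hm : ∀ α : Fin 2 → ℕ, cutMonomial [] α ρ x = 0 := fun α => by
    simp [cutMonomial, segCount]
  refine le_antisymm ((fupoly_le_iff _ _ _ _ _).2 fun α _ => (hm α).le) ?_
  have hc : IsCut [] u (fun k : Fin 2 => (k : ℕ)) :=
    ⟨fun _ _ h => h, rfl, rfl, fun k => k.elim0⟩
  exact (hm _).ge.trans (cutMonomial_le_fupoly hc ρ x)

theorem fupoly_nil_succ {L : ℕ} (u : Fin (L + 1) → σ) (ρ : Fin (L + 2) → Fin n)
    (x : σ → Fin n → TT) : fupoly [] u ρ x = ⊥ := by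
  refine le_bot_iff.1 ((fupoly_le_iff _ _ _ _ _).2 fun α h => ?_)
  simpa using h.2.2.2 0

theorem fupoly_eq_bot_or_exists_isCut (w : List σ) {L : ℕ} (u : Fin L → σ)
    (ρ : Fin (L + 1) → Fin n) (x : σ → Fin n → TT) :
    fupoly w u ρ x = ⊥ ∨ ∃ α, IsCut w u α ∧ fupoly w u ρ x = cutMonomial w α ρ x := by
  unfold fupoly
  refine (Finset.eq_empty_or_nonempty _).imp (fun h => (congrArg (Finset.sup · _) h).trans
    Finset.sup_empty) fun h => ?_
  obtain ⟨α, hα, heq⟩ := Finset.exists_mem_eq_sup _ h fun α : Fin (L + 2) → Fin (w.length + 2) =>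
    ∑ s : σ, ∑ k : Fin (L + 1), segCount w (α k.castSucc : ℕ) (α k.succ : ℕ) s • x s (ρ k)
  simp only [Finset.mem_filter, Finset.mem_univ, true_and] at hα
  obtain ⟨hα, h0, hl, hu⟩ := hα
  refine ⟨fun k => (α k : ℕ), ⟨fun p q hpq => hα p q hpq, ?_, ?_, hu⟩, heq⟩
  · simp [h0]
  · simp [hl]

theorem add_fupoly_le_fupoly_cons (s : σ) (t : List σ) {L : ℕ} (u : Fin L → σ)
    (ρ : Fin (L + 1) → Fin n) (x : σ → Fin n → TT) :
    x s (ρ 0) + fupoly t u ρ x ≤ fupoly (s :: t) u ρ x := by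
  obtain h | ⟨α, hα, h⟩ := fupoly_eq_bot_or_exists_isCut t u ρ x
  · simp [h]
  · rw [h, ← cutMonomial_cons_skip s t α hα.2.1 hα.one_le_succ]
    exact cutMonomial_le_fupoly (hα.cons_skip s) ρ x

theorem fupoly_tail_le_fupoly_cons (t : List σ) {L : ℕ} (u : Fin (L + 1) → σ)
    (ρ : Fin (L + 2) → Fin n) (x : σ → Fin n → TT) :
    fupoly t (Fin.tail u) (Fin.tail ρ) x ≤ fupoly (u 0 :: t) u ρ x := by
  rw [fupoly_le_iff]
  intro α hα
  rw [← cutMonomial_cons_take (u 0) t α hα.2.1]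
  exact cutMonomial_le_fupoly hα.cons_take ρ x

theorem fupoly_cons_zero (s : σ) (t : List σ) (u : Fin 0 → σ) (ρ : Fin 1 → Fin n)
    (x : σ → Fin n → TT) : fupoly (s :: t) u ρ x = x s (ρ 0) + fupoly t u ρ x := by
  refine le_antisymm ((fupoly_le_iff _ _ _ _ _).2 fun α hα => ?_)
    (add_fupoly_le_fupoly_cons s t u ρ x)
  have h1 : α 1 ≠ 1 := by
    have : α 1 = (s :: t).length + 1 := hα.2.2.1
    simp [this]
  obtain ⟨β, hβ, rfl⟩ := hα.exists_cons h1
  rw [cutMonomial_cons_skip s t β hβ.2.1 hβ.one_le_succ]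
  gcongr
  exact cutMonomial_le_fupoly hβ ρ x

theorem fupoly_cons_succ (s : σ) (t : List σ) {L : ℕ} (u : Fin (L + 1) → σ)
    (ρ : Fin (L + 2) → Fin n) (x : σ → Fin n → TT) :
    fupoly (s :: t) u ρ x = (x s (ρ 0) + fupoly t u ρ x) ⊔
      (if u 0 = s then fupoly t (Fin.tail u) (Fin.tail ρ) x else ⊥) := by
  refine le_antisymm ((fupoly_le_iff _ _ _ _ _).2 fun α hα => ?_)
    (sup_le (add_fupoly_le_fupoly_cons s t u ρ x) ?_)
  · by_cases h1 : α 1 = 1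
    · obtain ⟨hs, β, hβ, rfl⟩ := hα.exists_tail h1
      rw [cutMonomial_cons_take s t β hβ.2.1, if_pos hs]
      exact le_sup_of_le_right (cutMonomial_le_fupoly hβ _ x)
    · obtain ⟨β, hβ, rfl⟩ := hα.exists_cons h1
      rw [cutMonomial_cons_skip s t β hβ.2.1 hβ.one_le_succ]
      refine le_sup_of_le_left ?_
      gcongr
      exact cutMonomial_le_fupoly hβ ρ x
  · split_ifs with hs
    · subst hs
      exact fupoly_tail_le_fupoly_cons t u ρ x
    · exact bot_le

end Cuts

section Degeneration

open Filter

/-- Replace `-∞` by the real number `-N`. -/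
def truncate (N : ℕ) (a : TT) : TT :=
  ((a.unbotD (-(N : ℝ)) : ℝ) : TT)

theorem le_truncate (N : ℕ) (a : TT) : a ≤ truncate N a := by
  induction a using WithBot.recBotCoe <;> simp [truncate]

theorem eventually_truncate_lt {a c : TT} (h : a < c) : ∀ᶠ N in atTop, truncate N a < c := by
  induction c using WithBot.recBotCoe with
  | bot => simp at h
  | coe c =>
    induction a using WithBot.recBotCoe with
    | bot =>
      filter_upwards [tendsto_natCast_atTop_atTop.eventually_gt_atTop (-c)] with N hN
      simp only [truncate, WithBot.unbotD_bot, WithBot.coe_lt_coe]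
      linarith
    | coe a => exact .of_forall fun N => by simpa [truncate] using h

theorem exists_lt_lt_add_le {a b c : TT} (h : a + b < c) :
    ∃ a' b', a < a' ∧ b < b' ∧ a' + b' ≤ c := by
  induction c using WithBot.recBotCoe with
  | bot => simp at h
  | coe c =>
    induction a using WithBot.recBotCoe with
    | bot =>
      induction b using WithBot.recBotCoe with
      | bot => exact ⟨c, (0 : ℝ), WithBot.bot_lt_coe _, WithBot.bot_lt_coe _, by simp⟩
      | coe b =>
        refine ⟨((c - b - 1 : ℝ) : TT), ((b + 1 : ℝ) : TT), WithBot.bot_lt_coe _, ?_, ?_⟩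
        · exact WithBot.coe_lt_coe.2 (by linarith)
        · rw [← WithBot.coe_add]
          exact WithBot.coe_le_coe.2 (by linarith)
    | coe a =>
      induction b using WithBot.recBotCoe with
      | bot =>
        refine ⟨((a + 1 : ℝ) : TT), ((c - a - 1 : ℝ) : TT), ?_, WithBot.bot_lt_coe _, ?_⟩
        · exact WithBot.coe_lt_coe.2 (by linarith)
        · rw [← WithBot.coe_add]
          exact WithBot.coe_le_coe.2 (by linarith)
      | coe b =>
        rw [← WithBot.coe_add, WithBot.coe_lt_coe] at h
        refine ⟨((a + (c - a - b) / 2 : ℝ) : TT), ((b + (c - a - b) / 2 : ℝ) : TT), ?_, ?_, ?_⟩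
        · exact WithBot.coe_lt_coe.2 (by linarith)
        · exact WithBot.coe_lt_coe.2 (by linarith)
        · rw [← WithBot.coe_add]
          exact WithBot.coe_le_coe.2 (by linarith)

theorem eventually_add_lt {f g : ℕ → TT} {a b : TT}
    (hf : ∀ c, a < c → ∀ᶠ N in atTop, f N < c) (hg : ∀ c, b < c → ∀ᶠ N in atTop, g N < c)
    (c : TT) (h : a + b < c) : ∀ᶠ N in atTop, f N + g N < c := by
  obtain ⟨a', b', ha, hb, hc⟩ := exists_lt_lt_add_le h
  filter_upwards [hf a' ha, hg b' hb] with N h1 h2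
  refine lt_of_lt_of_le ?_ hc
  exact (add_le_add_right h2.le _).trans_lt
    (WithBot.add_lt_add_right (bot_le.trans_lt h2).ne' h1)

theorem eventually_nsmul_lt {f : ℕ → TT} {a : TT}
    (hf : ∀ c, a < c → ∀ᶠ N in atTop, f N < c) (m : ℕ) :
    ∀ c, m • a < c → ∀ᶠ N in atTop, m • f N < c := by
  induction m with
  | zero => exact fun c h => .of_forall fun _ => by simpa using h
  | succ m ih => simpa only [succ_nsmul] using eventually_add_lt ih hf

theorem eventually_sum_lt {κ : Type} {f : κ → ℕ → TT} {a : κ → TT}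
    (hf : ∀ i c, a i < c → ∀ᶠ N in atTop, f i N < c) (S : Finset κ) :
    ∀ c, ∑ i ∈ S, a i < c → ∀ᶠ N in atTop, ∑ i ∈ S, f i N < c := by
  classical
  induction S using Finset.induction_on with
  | empty => exact fun c h => .of_forall fun _ => by simpa using h
  | insert i S hi ih => simpa only [Finset.sum_insert hi] using eventually_add_lt (hf i) ih

variable {σ : Type} [Fintype σ] [DecidableEq σ] {n L : ℕ}

theorem eventually_fupoly_truncate_lt (w : List σ) (u : Fin L → σ) (ρ : Fin (L + 1) → Fin n)
    (x : σ → Fin n → TT) {c : TT} (h : fupoly w u ρ x < c) :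
    ∀ᶠ N in atTop, fupoly w u ρ (fun s p => truncate N (x s p)) < c := by
  have hc : ⊥ < c := bot_le.trans_lt h
  unfold fupoly at h ⊢
  simp only [Finset.sup_lt_iff hc] at h ⊢
  rw [Filter.eventually_all_finset]
  intro α hα
  exact eventually_sum_lt (fun s => eventually_sum_lt (fun k => eventually_nsmul_lt
    (fun _ => eventually_truncate_lt) _) _) _ _ (h α hα)

theorem fupoly_mono (w : List σ) (u : Fin L → σ) (ρ : Fin (L + 1) → Fin n)
    {x y : σ → Fin n → TT} (h : ∀ s p, x s p ≤ y s p) : fupoly w u ρ x ≤ fupoly w u ρ y :=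
  Finset.sup_mono_fun fun _ _ => Finset.sum_le_sum fun _ _ => Finset.sum_le_sum fun _ _ =>
    nsmul_le_nsmul_right (h _ _) _

theorem fupoly_le_fupoly_of_real {w v : List σ} {u : Fin L → σ} {ρ : Fin (L + 1) → Fin n}
    (h : ∀ x : σ → Fin n → ℝ, fupoly w u ρ (fun s p => ((x s p : ℝ) : TT))
      ≤ fupoly v u ρ (fun s p => ((x s p : ℝ) : TT))) (x : σ → Fin n → TT) :
    fupoly w u ρ x ≤ fupoly v u ρ x := by
  by_contra! hlt
  obtain ⟨N, hN⟩ := (eventually_fupoly_truncate_lt v u ρ x hlt).exists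
  exact (lt_irrefl _ ((fupoly_mono w u ρ fun s p => le_truncate N (x s p)).trans
    (h fun s p => (x s p).unbotD (-(N : ℝ))) |>.trans_lt hN))

end Degeneration

section Paths

variable {ι σ : Type} [Fintype ι]

theorem sup_add_distrib (f : ι → TT) (c : TT) :
    (Finset.univ.sup f) + c = Finset.univ.sup fun k => f k + c :=
  Finset.apply_sup_eq_sup_comp_of_linearOrder (· + c) (fun _ _ h => by dsimp only; gcongr) (by simp)

theorem add_sup_distrib (f : ι → TT) (c : TT) :
    c + (Finset.univ.sup f) = Finset.univ.sup fun k => c + f k :=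
  Finset.apply_sup_eq_sup_comp_of_linearOrder (c + ·) (fun _ _ h => by dsimp only; gcongr) (by simp)

theorem tmul_assoc (A B C : Matrix ι ι TT) : tmul (tmul A B) C = tmul A (tmul B C) := by
  funext i j
  simp only [tmul, sup_add_distrib, add_sup_distrib, add_assoc]
  exact Finset.sup_comm _ _ _

variable [DecidableEq ι]

/-- The product of the matrices of a word, with the tropical identity matrix for the empty word. -/
def wordMatrix (a : σ → Matrix ι ι TT) : List σ → Matrix ι ι TT
  | [] => fun i j => if i = j then 0 else ⊥
  | s :: t => tmul (a s) (wordMatrix a t)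

theorem tmul_wordMatrix_nil (a : σ → Matrix ι ι TT) (M : Matrix ι ι TT) :
    tmul M (wordMatrix a []) = M := by
  funext i j
  refine le_antisymm (Finset.sup_le fun k _ => ?_) ?_
  · by_cases h : k = j <;> simp [wordMatrix, h]
  · refine le_trans ?_ (Finset.le_sup (Finset.mem_univ j))
    simp [wordMatrix]

theorem foldl_tmul (a : σ → Matrix ι ι TT) (t : List σ) (M : Matrix ι ι TT) :
    t.foldl (fun M s => tmul M (a s)) M = tmul M (wordMatrix a t) := by
  induction t generalizing M with
  | nil => exact (tmul_wordMatrix_nil a M).symm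
  | cons s t ih => rw [List.foldl_cons, ih, tmul_assoc]; rfl

theorem evalWord_eq_wordMatrix (a : σ → Matrix ι ι TT) {w : List σ} (hw : w ≠ []) :
    evalWord a w = wordMatrix a w := by
  cases w with
  | nil => exact absurd rfl hw
  | cons s t => exact foldl_tmul a t (a s)

theorem add_wordMatrix_le (a : σ → Matrix ι ι TT) (s : σ) (t : List σ) (i k j : ι) :
    a s i k + wordMatrix a t k j ≤ wordMatrix a (s :: t) i j :=
  Finset.le_sup (f := fun k => a s i k + wordMatrix a t k j) (Finset.mem_univ k)

variable {n : ℕ}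

/-- The total weight of the steps `ρ_k → ρ_{k+1}` labelled by the letters `u_k`. -/
def stepWeight (a : σ → Matrix (Fin n) (Fin n) TT) {L : ℕ} (u : Fin L → σ)
    (ρ : Fin (L + 1) → Fin n) : TT :=
  ∑ k : Fin L, a (u k) (ρ k.castSucc) (ρ k.succ)

theorem stepWeight_succ (a : σ → Matrix (Fin n) (Fin n) TT) {L : ℕ} (u : Fin (L + 1) → σ)
    (ρ : Fin (L + 2) → Fin n) :
    stepWeight a u ρ = a (u 0) (ρ 0) (ρ 1) + stepWeight a (Fin.tail u) (Fin.tail ρ) := by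
  unfold stepWeight
  rw [Fin.sum_univ_succ]
  rfl

variable [DecidableEq σ]

/-- The matrices with diagonal entries `x` whose only off-diagonal steps are `ρ_k → ρ_{k+1}`,
labelled `u_k`, of weight `0`. -/
def pathMatrix (x : σ → Fin n → TT) {L : ℕ} (u : Fin L → σ) (ρ : Fin (L + 1) → Fin n) (s : σ) :
    Matrix (Fin n) (Fin n) TT :=
  fun p q => if p = q then x s p else
    if ∃ k : Fin L, p = ρ k.castSucc ∧ q = ρ k.succ ∧ u k = s then 0 else ⊥

theorem isUT_pathMatrix (x : σ → Fin n → TT) {L : ℕ} (u : Fin L → σ) {ρ : Fin (L + 1) → Fin n}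
    (hρ : StrictMono ρ) (s : σ) : IsUT (pathMatrix x u ρ s) := by
  intro i j hji
  rw [pathMatrix, if_neg hji.ne', if_neg]
  rintro ⟨k, rfl, rfl, -⟩
  exact lt_asymm hji (hρ k.castSucc_lt_succ)

variable [Fintype σ]

theorem stepWeight_add_fupoly_le (a : σ → Matrix (Fin n) (Fin n) TT) (w : List σ) {L : ℕ}
    (u : Fin L → σ) (ρ : Fin (L + 1) → Fin n) :
    stepWeight a u ρ + fupoly w u ρ (fun s p => a s p p)
      ≤ wordMatrix a w (ρ 0) (ρ (Fin.last L)) := by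
  induction w generalizing L with
  | nil =>
    cases L with
    | zero => simp [stepWeight, fupoly_nil_zero, wordMatrix]
    | succ L => simp [fupoly_nil_succ]
  | cons s t ih =>
    have hskip : stepWeight a u ρ + (a s (ρ 0) (ρ 0) + fupoly t u ρ (fun s p => a s p p))
        ≤ wordMatrix a (s :: t) (ρ 0) (ρ (Fin.last L)) := by
      rw [add_left_comm]
      grw [ih u ρ]
      exact add_wordMatrix_le a s t _ _ _
    cases L with
    | zero => rwa [fupoly_cons_zero]
    | succ L =>
      rw [fupoly_cons_succ, add_max]
      refine sup_le hskip ?_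
      split_ifs with hs
      · subst hs
        rw [stepWeight_succ, add_assoc]
        grw [ih (Fin.tail u) (Fin.tail ρ)]
        exact add_wordMatrix_le a (u 0) t _ _ _
      · simp

theorem wordMatrix_eq_bot_or_exists_path (a : σ → Matrix (Fin n) (Fin n) TT)
    (ha : ∀ s, IsUT (a s)) (w : List σ) (i j : Fin n) :
    wordMatrix a w i j = ⊥ ∨ ∃ (L : ℕ) (u : Fin L → σ) (ρ : Fin (L + 1) → Fin n),
      StrictMono ρ ∧ ρ 0 = i ∧ ρ (Fin.last L) = j ∧
        wordMatrix a w i j ≤ stepWeight a u ρ + fupoly w u ρ (fun s p => a s p p) := by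
  induction w generalizing i with
  | nil =>
    by_cases h : i = j
    · exact .inr ⟨0, Fin.elim0, fun _ => i, Subsingleton.strictMono (α := Fin 1) _, rfl, h,
        by simp [wordMatrix, h, stepWeight, fupoly_nil_zero]⟩
    · exact .inl (by simp [wordMatrix, h])
  | cons s t ih =>
    obtain ⟨k, -, hk⟩ := Finset.exists_mem_eq_sup Finset.univ ⟨i, Finset.mem_univ i⟩
      (fun k => a s i k + wordMatrix a t k j)
    change wordMatrix a (s :: t) i j = _ at hk
    rw [hk]
    rcases lt_or_ge k i with hki | hik
    · exact .inl (by simp [ha s i k hki])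
    obtain h | ⟨L, u, ρ, hρ, rfl, hj, hle⟩ := ih k
    · exact .inl (by simp [h])
    right
    obtain rfl | hik := hik.eq_or_lt
    · refine ⟨L, u, ρ, hρ, rfl, hj, ?_⟩
      grw [hle, ← add_fupoly_le_fupoly_cons, add_left_comm]
    · refine ⟨L + 1, Fin.cons s u, Fin.cons i ρ, ?_, rfl, ?_, ?_⟩
      · intro p q
        have : ∀ q, i < ρ q := fun q => hik.trans_le (hρ.monotone (Fin.zero_le q))
        cases p using Fin.cases <;> cases q using Fin.cases <;> simp [hρ.lt_iff_lt, this]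
      · rw [← Fin.succ_last, Fin.cons_succ, hj]
      · have := fupoly_tail_le_fupoly_cons t (Fin.cons s u : Fin (L + 1) → σ)
          (Fin.cons i ρ : Fin (L + 2) → Fin n) (fun s p => a s p p)
        rw [Fin.tail_cons, Fin.tail_cons, Fin.cons_zero] at this
        rw [stepWeight_succ, Fin.tail_cons, Fin.tail_cons, add_assoc]
        grw [hle, this]
        rfl

theorem wordMatrix_le_fupoly (a : σ → Matrix (Fin n) (Fin n) TT) (w : List σ) {L : ℕ}
    (u : Fin L → σ) (ρ : Fin (L + 1) → Fin n) (hρ : StrictMono ρ)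
    (hstep : ∀ (k : Fin L) s q, q ≠ ρ k.castSucc →
      a s (ρ k.castSucc) q ≤ if q = ρ k.succ ∧ u k = s then 0 else ⊥)
    (hlast : ∀ s q, q ≠ ρ (Fin.last L) → a s (ρ (Fin.last L)) q = ⊥) :
    wordMatrix a w (ρ 0) (ρ (Fin.last L)) ≤ fupoly w u ρ (fun s p => a s p p) := by
  induction w generalizing L with
  | nil =>
    cases L with
    | zero => simp [fupoly_nil_zero, wordMatrix]
    | succ L =>
      have : ρ 0 ≠ ρ (Fin.last (L + 1)) := (hρ (Fin.last_pos)).ne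
      simp [wordMatrix, this]
  | cons s t ih =>
    change Finset.univ.sup (fun q => a s (ρ 0) q + wordMatrix a t q (ρ (Fin.last L))) ≤ _
    refine Finset.sup_le fun q _ => ?_
    by_cases hq : q = ρ 0
    · subst hq
      grw [ih u ρ hρ hstep hlast]
      exact add_fupoly_le_fupoly_cons s t u ρ fun s p => a s p p
    cases L with
    | zero =>
      have h0 : a s (ρ 0) q = ⊥ := hlast s q hq
      simp [h0]
    | succ L =>
      have h0 := hstep 0 s q hq
      split_ifs at h0 with h
      · obtain ⟨rfl, rfl⟩ := h
        rw [Fin.castSucc_zero] at h0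
        grw [h0, zero_add, ← fupoly_tail_le_fupoly_cons]
        exact ih (Fin.tail u) (Fin.tail ρ) (fun p q h => hρ (Fin.succ_lt_succ_iff.2 h))
          (fun k => hstep k.succ) hlast
      · rw [Fin.castSucc_zero, le_bot_iff] at h0
        simp [h0]

theorem wordMatrix_pathMatrix (x : σ → Fin n → TT) (w : List σ) {L : ℕ} (u : Fin L → σ)
    {ρ : Fin (L + 1) → Fin n} (hρ : StrictMono ρ) :
    wordMatrix (pathMatrix x u ρ) w (ρ 0) (ρ (Fin.last L)) = fupoly w u ρ x := by
  have hx : (fun s p => pathMatrix x u ρ s p p) = x := by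
    funext s p
    simp [pathMatrix]
  have hw : stepWeight (pathMatrix x u ρ) u ρ = 0 := by
    refine Finset.sum_eq_zero fun k _ => ?_
    rw [pathMatrix, if_neg (hρ k.castSucc_lt_succ).ne, if_pos ⟨k, rfl, rfl, rfl⟩]
  refine le_antisymm ?_ ?_
  · conv_rhs => rw [← hx]
    refine wordMatrix_le_fupoly _ w u ρ hρ (fun k s q hq => ?_) fun s q hq => ?_
    · rw [pathMatrix, if_neg hq.symm]
      split_ifs with h1 h2 h2
      · exact le_rfl
      · obtain ⟨l, hl, hq, hs⟩ := h1
        obtain rfl := Fin.castSucc_injective _ (hρ.injective hl)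
        exact absurd ⟨hq, hs⟩ h2
      · exact bot_le
      · exact le_rfl
    · rw [pathMatrix, if_neg hq.symm, if_neg]
      rintro ⟨k, hk, -⟩
      exact (Fin.castSucc_lt_last k).ne' (hρ.injective hk)
  · simpa [hx, hw] using stepWeight_add_fupoly_le (pathMatrix x u ρ) w u ρ

theorem wordMatrix_le_wordMatrix {w v : List σ}
    (h : ∀ L ≤ n - 1, ∀ (u : Fin L → σ) (ρ : Fin (L + 1) → Fin n), StrictMono ρ →
      ∀ x : σ → Fin n → TT, fupoly w u ρ x ≤ fupoly v u ρ x)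
    (a : σ → Matrix (Fin n) (Fin n) TT) (ha : ∀ s, IsUT (a s)) (i j : Fin n) :
    wordMatrix a w i j ≤ wordMatrix a v i j := by
  obtain hb | ⟨L, u, ρ, hρ, rfl, rfl, hle⟩ := wordMatrix_eq_bot_or_exists_path a ha w i j
  · simp [hb]
  · have hL : L + 1 ≤ n := by
      simpa using Fintype.card_le_of_injective ρ hρ.injective
    grw [hle, h L (by omega) u ρ hρ]
    exact stepWeight_add_fupoly_le a v u ρ

end Paths

/-- A semigroup identity `w = v` over a finite alphabet `Σ` holds in
`UT_n(𝕋)` iff for every word `u` of length `L ≤ n-1` and every strictly increasing sequence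
`ρ₀ < ρ₁ < ⋯ < ρ_L` in `{1,…,n}`, the functions `f_{u,ρ}^w` and `f_{u,ρ}^v` agree at every
real point `x ∈ ℝ^{Σ×{1,…,n}}`. -/
theorem stmt_14 (n : ℕ) (σ : Type) [Fintype σ] [DecidableEq σ]
    (w v : List σ) (hw : w ≠ []) (hv : v ≠ []) :
    (∀ a : σ → Matrix (Fin n) (Fin n) TT, (∀ s, IsUT (a s)) →
      evalWord a w = evalWord a v)
    ↔ (∀ (L : ℕ), L ≤ n - 1 → ∀ (u : Fin L → σ) (ρ : Fin (L + 1) → Fin n),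
        (∀ p q, p < q → ρ p < ρ q) →
        ∀ x : σ → Fin n → ℝ,
          fupoly w u ρ (fun s p => ((x s p : ℝ) : TT))
            = fupoly v u ρ (fun s p => ((x s p : ℝ) : TT))) := by
  constructor
  · intro h L _ u ρ hρ x
    have hρ' : StrictMono ρ := fun p q => hρ p q
    have := h _ (isUT_pathMatrix (fun s p => ((x s p : ℝ) : TT)) u hρ')
    rw [evalWord_eq_wordMatrix _ hw, evalWord_eq_wordMatrix _ hv] at this
    rw [← wordMatrix_pathMatrix _ w u hρ', this, wordMatrix_pathMatrix _ v u hρ']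
  · intro h a ha
    rw [evalWord_eq_wordMatrix _ hw, evalWord_eq_wordMatrix _ hv]
    funext i j
    refine le_antisymm ?_ ?_
    · exact wordMatrix_le_wordMatrix (fun L hL u ρ hρ => fupoly_le_fupoly_of_real fun x =>
        (h L hL u ρ (fun _ _ hpq => hρ hpq) x).le) a ha i j
    · exact wordMatrix_le_wordMatrix (fun L hL u ρ hρ => fupoly_le_fupoly_of_real fun x =>
        (h L hL u ρ (fun _ _ hpq => hρ hpq) x).ge) a ha i j
end
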